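/- For every η ∈ [0,1), define φ̂_η : (0,∞) → ℝ by φ̂_η(b) = liminf_{n→∞} n^{-3/2}·log P_{⌊b·n^{3/2}/2⌋}( X ≤ η·E X ), where E X is the expected number of triangles of G(n, ⌊b·n^{3/2}/2⌋). Then there exists b* ∈ (0,∞) such that φ̂_η is not real-analytic at b*. -/

import Mathlib

open Filter
open scoped BigOperators symmDiff Classical

noncomputable section

/-- Number of edges of a labeled simple graph on `Fin n`. -/
def edgeCount {n : ℕ} (G : SimpleGraph (Fin n)) : ℕ := Nat.card G.edgeSet

/-- Number of triangles of a labeled simple graph on `Fin n`. -/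
def triCount {n : ℕ} (G : SimpleGraph (Fin n)) : ℕ :=
  Nat.card {s : Finset (Fin n) // G.IsNClique 3 s}

/-- Probability of the event `A` under the Erdős–Rényi random graph `G(n,p)`. -/
def erProb (n : ℕ) (p : ℝ) (A : Set (SimpleGraph (Fin n))) : ℝ :=
  ∑ G : SimpleGraph (Fin n),
    if G ∈ A then p ^ edgeCount G * (1 - p) ^ (n.choose 2 - edgeCount G) else 0

/-- Conditional probability `P_p(A | B)` for `G(n,p)`. -/
def erCondProb (n : ℕ) (p : ℝ) (A B : Set (SimpleGraph (Fin n))) : ℝ :=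
  erProb n p (A ∩ B) / erProb n p B

/-- Probability of the event `A` under the uniform random graph `G(n,m)`. -/
def gnmProb (n m : ℕ) (A : Set (SimpleGraph (Fin n))) : ℝ :=
  (Nat.card {G : SimpleGraph (Fin n) // edgeCount G = m ∧ G ∈ A} : ℝ) /
    ((n.choose 2).choose m : ℝ)

/-- Expected number of triangles of `G(n,m)`. -/
def gnmExpTri (n m : ℕ) : ℝ :=
  (∑ G : SimpleGraph (Fin n), if edgeCount G = m then (triCount G : ℝ) else 0) /
    ((n.choose 2).choose m : ℝ)

/-- Gibbs weight `λ^{|G|} (1-ζ)^{X(G)}`. -/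
def gibbsWeight {n : ℕ} (lam zeta : ℝ) (G : SimpleGraph (Fin n)) : ℝ :=
  lam ^ edgeCount G * (1 - zeta) ^ triCount G

/-- The partition function `Z(λ,ζ)`. -/
def Zfun (n : ℕ) (lam zeta : ℝ) : ℝ := ∑ G : SimpleGraph (Fin n), gibbsWeight lam zeta G

/-- Probability of the event `A` under the Gibbs measure `μ_{λ,ζ}`. -/
def gibbsProb (n : ℕ) (lam zeta : ℝ) (A : Set (SimpleGraph (Fin n))) : ℝ :=
  (∑ G : SimpleGraph (Fin n), if G ∈ A then gibbsWeight lam zeta G else 0) / Zfun n lam zeta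

/-- Expectation of `f` under the Gibbs measure `μ_{λ,ζ}`. -/
def gibbsExp (n : ℕ) (lam zeta : ℝ) (f : SimpleGraph (Fin n) → ℝ) : ℝ :=
  (∑ G : SimpleGraph (Fin n), f G * gibbsWeight lam zeta G) / Zfun n lam zeta

/-- Number of edges of `H` with both endpoints in `S`. -/
def edgesIn {V : Type*} (H : SimpleGraph V) (S : Finset V) : ℕ :=
  Nat.card {e : Sym2 V // e ∈ H.edgeSet ∧ ∀ v ∈ e, v ∈ S}

/-- Weight `λ^{|S|} (1-ζ)^{|E(S)|}` of the measure `ν_{H,λ,ζ}`. -/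
def nuWeight {V : Type*} (H : SimpleGraph V) (lam zeta : ℝ) (S : Finset V) : ℝ :=
  lam ^ S.card * (1 - zeta) ^ edgesIn H S

/-- The partition function `Ξ_H(λ,ζ)`. -/
def XiFun {V : Type*} [Fintype V] (H : SimpleGraph V) (lam zeta : ℝ) : ℝ :=
  ∑ S : Finset V, nuWeight H lam zeta S

/-- The probability of `S` under `ν_{H,λ,ζ}`. -/
def nuProb {V : Type*} [Fintype V] (H : SimpleGraph V) (lam zeta : ℝ) (S : Finset V) : ℝ :=
  nuWeight H lam zeta S / XiFun H lam zeta

/-- `W` is the Lambert-W function on `[0,∞)`: for `x ≥ 0`, `W x` is the unique `w ≥ 0`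
with `w·e^w = x`. -/
def IsLambertW (W : ℝ → ℝ) : Prop :=
  ∀ x : ℝ, 0 ≤ x → (0 ≤ W x ∧ W x * Real.exp (W x) = x ∧
    ∀ w : ℝ, 0 ≤ w → w * Real.exp w = x → w = W x)

/-- `η* = (W(2/e)/(2/e))^{3/2}`. -/
def etaStar (W : ℝ → ℝ) : ℝ := (W (2 / Real.exp 1) / (2 / Real.exp 1)) ^ ((3 : ℝ) / 2)

/-- The condition `c < c̄(η)` where `c̄(η) = 1/√(e(1−η/η*))` for `η < η*` and `+∞` otherwise. -/
def LtCbar (W : ℝ → ℝ) (c η : ℝ) : Prop :=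
  η < etaStar W → c < 1 / Real.sqrt (Real.exp 1 * (1 - η / etaStar W))

/-- The left-hand side of the equation defining `ζ(c,η)`, interpreted as `1` at `ζ = 0`. -/
def zetaLHS (W : ℝ → ℝ) (c zeta : ℝ) : ℝ :=
  (1 - zeta) * (if zeta = 0 then 1 else
    (W (2 * zeta * c ^ 2) / (2 * zeta * c ^ 2)) ^ ((3 : ℝ) / 2))



/-- Number of members of `𝒜` contained in `U`. -/
def containedCount {E : Type*} (𝒜 : Finset (Finset E)) (U : Finset E) : ℕ :=
  (𝒜.filter (· ⊆ U)).card

/-- Total weight `λ^{|U|} w^{#{t ∈ 𝒜 : t ⊆ U}}` of the sets `U` containing `P`. -/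
def pinnedSum {E : Type*} [Fintype E] (lam w : ℝ) (𝒜 : Finset (Finset E)) (P : Finset E) : ℝ :=
  ∑ U : Finset E with P ⊆ U, lam ^ U.card * w ^ containedCount 𝒜 U

lemma containedCount_eq_zero {E : Type*} {𝒜 : Finset (Finset E)} {U : Finset E}
    (h : ∀ t ∈ 𝒜, ¬ t ⊆ U) : containedCount 𝒜 U = 0 := by
  rw [containedCount, Finset.card_eq_zero, Finset.filter_eq_empty_iff]
  exact fun t ht => h t ht

lemma containedCount_mono {E : Type*} {𝒜 ℬ : Finset (Finset E)} (h : 𝒜 ⊆ ℬ) (U : Finset E) :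
    containedCount 𝒜 U ≤ containedCount ℬ U :=
  Finset.card_le_card (Finset.filter_subset_filter _ h)

lemma containedCount_mono_right {E : Type*} (𝒜 : Finset (Finset E)) {U V : Finset E} (h : U ⊆ V) :
    containedCount 𝒜 U ≤ containedCount 𝒜 V :=
  Finset.card_le_card (Finset.monotone_filter_right _ fun _ _ ht => ht.trans h)

section PinnedSum

variable {E : Type*} [Fintype E] {lam w : ℝ}

lemma pinnedSum_nonneg (hl : 0 ≤ lam) (hw : 0 ≤ w) (𝒜 : Finset (Finset E)) (P : Finset E) :
    0 ≤ pinnedSum lam w 𝒜 P :=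
  Finset.sum_nonneg fun _ _ => by positivity

lemma pinnedSum_anti_right (hl : 0 ≤ lam) (hw : 0 ≤ w) (𝒜 : Finset (Finset E))
    {P Q : Finset E} (h : P ⊆ Q) : pinnedSum lam w 𝒜 Q ≤ pinnedSum lam w 𝒜 P :=
  Finset.sum_le_sum_of_subset_of_nonneg
    (Finset.monotone_filter_right _ fun _ _ ht => h.trans ht) fun _ _ _ => by positivity

lemma pinnedSum_anti_left (hl : 0 ≤ lam) (hw : 0 ≤ w) (hw1 : w ≤ 1)
    {𝒜 ℬ : Finset (Finset E)} (h : 𝒜 ⊆ ℬ) (P : Finset E) :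
    pinnedSum lam w ℬ P ≤ pinnedSum lam w 𝒜 P :=
  Finset.sum_le_sum fun U _ => mul_le_mul_of_nonneg_left
    (pow_le_pow_of_le_one hw hw1 (containedCount_mono h U)) (by positivity)

lemma pinnedSum_insert {𝒜 : Finset (Finset E)} {t : Finset E} (ht : t ∉ 𝒜) (P : Finset E) :
    pinnedSum lam w (insert t 𝒜) P
      = pinnedSum lam w 𝒜 P - (1 - w) * pinnedSum lam w 𝒜 (P ∪ t) := by
  unfold pinnedSum
  have h2 : (Finset.univ.filter fun U : Finset E => P ∪ t ⊆ U)
      = (Finset.univ.filter fun U : Finset E => P ⊆ U).filter (fun U => t ⊆ U) := by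
    ext U; simp [Finset.union_subset_iff]
  rw [h2, Finset.sum_filter (p := fun U => t ⊆ U), Finset.mul_sum, ← Finset.sum_sub_distrib]
  refine Finset.sum_congr rfl fun U _ => ?_
  unfold containedCount
  rw [Finset.filter_insert]
  split_ifs with h
  · rw [Finset.card_insert_of_notMem (by simp [ht]), pow_succ]; ring
  · simp

lemma pinnedSum_filter_insert (𝒜 : Finset (Finset E)) {f : E} {P : Finset E} (hf : f ∉ P) :
    pinnedSum lam w (𝒜.filter (f ∉ ·)) (insert f P)
      = lam * (pinnedSum lam w 𝒜 P - pinnedSum lam w 𝒜 (insert f P)) := by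
  have h1 : pinnedSum lam w 𝒜 P = pinnedSum lam w 𝒜 (insert f P)
      + ∑ U : Finset E with P ⊆ U ∧ f ∉ U, lam ^ U.card * w ^ containedCount 𝒜 U := by
    unfold pinnedSum
    rw [← Finset.sum_filter_add_sum_filter_not _ (fun U => f ∈ U), Finset.filter_filter,
      Finset.filter_filter]
    congr 2
    ext U; simp [Finset.insert_subset_iff, and_comm]
  rw [h1, add_sub_cancel_left, Finset.mul_sum]
  unfold pinnedSum
  refine Finset.sum_nbij' (fun U => U.erase f) (fun U => insert f U) ?_ ?_ ?_ ?_ ?_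
  · intro U hU
    simp only [Finset.mem_filter, Finset.mem_univ, true_and, Finset.insert_subset_iff] at hU ⊢
    exact ⟨Finset.subset_erase.2 ⟨hU.2, hf⟩, by simp⟩
  · intro U hU
    simp only [Finset.mem_filter, Finset.mem_univ, true_and] at hU ⊢
    exact Finset.insert_subset_insert _ hU.1
  · intro U hU
    simp only [Finset.mem_filter, Finset.mem_univ, true_and, Finset.insert_subset_iff] at hU
    exact Finset.insert_erase hU.1
  · intro U hU
    simp only [Finset.mem_filter, Finset.mem_univ, true_and] at hU
    exact Finset.erase_insert hU.2
  · intro U hU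
    simp only [Finset.mem_filter, Finset.mem_univ, true_and, Finset.insert_subset_iff] at hU
    have : containedCount (𝒜.filter (f ∉ ·)) U = containedCount 𝒜 (U.erase f) := by
      unfold containedCount
      rw [Finset.filter_filter]
      congr 1
      ext t; simp [Finset.subset_erase, and_comm]
    rw [this, ← mul_assoc, ← pow_succ', Finset.card_erase_add_one hU.1]

lemma pinnedSum_insert_le (hl : 0 ≤ lam) (hw : 0 ≤ w) (hw1 : w ≤ 1) (𝒜 : Finset (Finset E))
    {f : E} {P : Finset E} (hf : f ∉ P) :
    pinnedSum lam w 𝒜 (insert f P) ≤ lam * pinnedSum lam w 𝒜 P := by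
  have h1 := pinnedSum_anti_left (P := insert f P) hl hw hw1 (Finset.filter_subset (f ∉ ·) 𝒜)
  rw [pinnedSum_filter_insert 𝒜 hf] at h1
  have h2 := pinnedSum_nonneg hl hw 𝒜 (insert f P)
  nlinarith

/-- Two-sided bounds on the conditional occupation probability of an element `f`, uniformly over
at most `D` pinned elements and all activity patterns in which only sets meeting the pinned
elements may be inactive. -/
def OccBounds (T : Finset (Finset E)) (lam w : ℝ) (D : ℕ) (lo hi : ℝ) : Prop :=
  ∀ 𝒜 ⊆ T, ∀ P : Finset E, P.card ≤ D → (∀ t ∈ T, Disjoint t P → t ∈ 𝒜) →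
    ∀ f ∉ P, (∀ t ∈ 𝒜, ¬ t ⊆ insert f P) →
      lo * pinnedSum lam w 𝒜 P ≤ pinnedSum lam w 𝒜 (insert f P) ∧
      pinnedSum lam w 𝒜 (insert f P) ≤ hi * pinnedSum lam w 𝒜 P

lemma occBounds_zero (hl : 0 ≤ lam) (hw : 0 ≤ w) (hw1 : w ≤ 1) (T : Finset (Finset E)) (D : ℕ) :
    OccBounds T lam w D 0 lam := by
  intro 𝒜 _ P _ _ f hf _
  exact ⟨by rw [zero_mul]; exact pinnedSum_nonneg hl hw _ _, pinnedSum_insert_le hl hw hw1 𝒜 hf⟩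

/-- The combinatorics of the triples of edges forming triangles of the complete graph
on `n` vertices. -/
structure IsTriangleSystem (T : Finset (Finset E)) (n : ℕ) : Prop where
  card_elements : Fintype.card E = n.choose 2
  card_triples : T.card = n.choose 3
  uniform : ∀ t ∈ T, t.card = 3
  linear : ∀ e f : E, e ≠ f → (T.filter fun t => e ∈ t ∧ f ∈ t).card ≤ 1
  regular : ∀ e : E, (T.filter (e ∈ ·)).card = n - 2

lemma IsTriangleSystem.containedCount_empty {T : Finset (Finset E)} {n : ℕ}
    (hT : IsTriangleSystem T n) : containedCount T ∅ = 0 := by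
  refine containedCount_eq_zero fun t ht hsub => ?_
  have := hT.uniform t ht
  simp [Finset.subset_empty.1 hsub] at this

/-- `t` is generic for `(𝒜, P)` if it avoids `P` and pinning it creates no other member of `𝒜`. -/
def IsGeneric (𝒜 : Finset (Finset E)) (P t : Finset E) : Prop :=
  Disjoint t P ∧ ∀ t' ∈ 𝒜, t' ⊆ P ∪ t → t' = t

lemma IsTriangleSystem.eq_of_mem {T : Finset (Finset E)} {n : ℕ} (hT : IsTriangleSystem T n)
    {e f : E} (hef : e ≠ f) {t t' : Finset E} (ht : t ∈ T) (ht' : t' ∈ T)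
    (h1 : e ∈ t) (h2 : f ∈ t) (h3 : e ∈ t') (h4 : f ∈ t') : t = t' :=
  Finset.card_le_one.1 (hT.linear e f hef) t (by simp [*]) t' (by simp [*])

lemma IsTriangleSystem.card_not_generic_le {T : Finset (Finset E)} {n : ℕ}
    (hT : IsTriangleSystem T n) {𝒜 : Finset (Finset E)} (h𝒜 : 𝒜 ⊆ T) {P : Finset E} {D : ℕ}
    (hP : P.card ≤ D) {f : E} (hf : f ∉ P) (hnd : ∀ t ∈ 𝒜, ¬ t ⊆ insert f P) :
    (T.filter fun t => f ∈ t ∧ ¬ IsGeneric 𝒜 P t).card ≤ D + 3 * D ^ 2 := by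
  let B₁ : Finset (Finset E) := P.biUnion fun p => T.filter fun t => f ∈ t ∧ p ∈ t
  let B₂ : Finset (Finset E) := P.offDiag.biUnion fun q =>
    (T.filter fun t' => q.1 ∈ t' ∧ q.2 ∈ t').biUnion fun t' => (t'.erase f).biUnion fun y =>
      T.filter fun t => f ∈ t ∧ y ∈ t
  have hsub : (T.filter fun t => f ∈ t ∧ ¬ IsGeneric 𝒜 P t) ⊆ B₁ ∪ B₂ := by
    intro t ht
    obtain ⟨htT, hft, hng⟩ := Finset.mem_filter.1 ht
    by_cases hd : Disjoint t P
    · have : ∃ t' ∈ 𝒜, t' ⊆ P ∪ t ∧ t' ≠ t := by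
        by_contra hcon
        push Not at hcon
        exact hng ⟨hd, hcon⟩
      obtain ⟨t', ht'𝒜, hsub, hne⟩ := this
      have ht'T := h𝒜 ht'𝒜
      have hinter : (t' ∩ t).card ≤ 1 := by
        rw [Finset.card_le_one]
        intro a ha b hb
        by_contra hab
        simp only [Finset.mem_inter] at ha hb
        exact hne (hT.eq_of_mem hab ht'T htT ha.1 hb.1 ha.2 hb.2)
      have hcard : (t' ∩ P).card + (t' ∩ t).card ≥ 3 := by
        rw [← hT.uniform t' ht'T]
        refine le_trans (Finset.card_le_card ?_) (Finset.card_union_le _ _)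
        intro a ha
        have := hsub ha
        simp only [Finset.mem_union, Finset.mem_inter] at this ⊢
        tauto
      obtain ⟨p, hp, q, hq, hpq⟩ := Finset.one_lt_card.1 (show 1 < (t' ∩ P).card by omega)
      obtain ⟨y, hy, hyP⟩ := Finset.not_subset.1 (hnd t' ht'𝒜)
      simp only [Finset.mem_insert, not_or] at hyP
      simp only [Finset.mem_inter] at hp hq
      have hyt : y ∈ t := by
        have := hsub hy
        simp only [Finset.mem_union] at this
        tauto
      refine Finset.mem_union_right _ (Finset.mem_biUnion.2 ⟨(p, q), by simp [hp.2, hq.2, hpq], ?_⟩)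
      refine Finset.mem_biUnion.2 ⟨t', by simp [ht'T, hp.1, hq.1], ?_⟩
      exact Finset.mem_biUnion.2 ⟨y, by simp [hy, hyP.1], by simp [htT, hft, hyt]⟩
    · obtain ⟨p, hpt, hpP⟩ := Finset.not_disjoint_iff.1 hd
      exact Finset.mem_union_left _ (Finset.mem_biUnion.2 ⟨p, hpP, by simp [htT, hft, hpt]⟩)
  have hB₁ : B₁.card ≤ D := by
    refine (Finset.card_biUnion_le_card_mul _ _ 1 fun p hp => ?_).trans (by simpa using hP)
    exact hT.linear f p (by rintro rfl; exact hf hp)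
  have hB₂ : B₂.card ≤ 3 * D ^ 2 := by
    have hoff : P.offDiag.card ≤ D ^ 2 := by
      rw [Finset.offDiag_card]
      calc P.card * P.card - P.card ≤ P.card * P.card := Nat.sub_le _ _
        _ ≤ D * D := Nat.mul_le_mul hP hP
        _ = D ^ 2 := by ring
    refine (Finset.card_biUnion_le_card_mul _ _ 3 fun q hq => ?_).trans (by omega)
    have hq' : q.1 ≠ q.2 := (Finset.mem_offDiag.1 hq).2.2
    refine (Finset.card_biUnion_le_card_mul _ _ 3 fun t' ht' => ?_).trans
      (by have := hT.linear q.1 q.2 hq'; omega)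
    refine (Finset.card_biUnion_le_card_mul _ _ 1 fun y hy => ?_).trans ?_
    · exact hT.linear f y (Finset.ne_of_mem_erase hy).symm
    · rw [mul_one, ← hT.uniform t' (Finset.mem_filter.1 ht').1]
      exact Finset.card_le_card (Finset.erase_subset _ _)
  calc _ ≤ (B₁ ∪ B₂).card := Finset.card_le_card hsub
    _ ≤ B₁.card + B₂.card := Finset.card_union_le _ _
    _ ≤ D + 3 * D ^ 2 := by omega

set_option maxHeartbeats 1000000 in
lemma OccBounds.step {T : Finset (Finset E)} {n : ℕ} (hT : IsTriangleSystem T n)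
    (hl : 0 ≤ lam) (hl1 : lam ≤ 1) (hw : 0 ≤ w) (hw1 : w ≤ 1) {D : ℕ} {lo hi : ℝ}
    (hlo : 0 ≤ lo) (hlo1 : lo ≤ 1) (hhi : 0 ≤ hi) (hhi1 : hi ≤ 1)
    (h : OccBounds T lam w (D + 2) lo hi) :
    OccBounds T lam w D
      (lam / (1 + lam) * ((1 - (1 - w) * hi ^ 2) ^ (n - 2) * (1 - lam) ^ (D + 3 * D ^ 2)))
      (lam * (1 - (1 - w) * lo ^ 2) ^ (n - 2 - (D + 3 * D ^ 2))) := by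
  intro 𝒜 h𝒜 P hP hact f hf hnd
  set K := D + 3 * D ^ 2 with hK
  have hbad := hT.card_not_generic_le h𝒜 hP hf hnd
  have hz0 : 0 ≤ 1 - w := by linarith
  have hz1 : 1 - w ≤ 1 := by linarith
  set 𝒜₀ := 𝒜.filter (f ∉ ·) with h𝒜₀
  set P' := insert f P with hP'
  set Y := fun (ℬ : Finset (Finset E)) (Q : Finset E) => pinnedSum lam w ℬ Q with hY
  set G : Finset E → Prop := IsGeneric 𝒜 P with hG
  have hYnn : ∀ ℬ Q, 0 ≤ Y ℬ Q := fun ℬ Q => pinnedSum_nonneg hl hw ℬ Q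
  have hu0 : 0 ≤ 1 - (1 - w) * lo ^ 2 := by
    have : lo ^ 2 ≤ 1 := pow_le_one₀ hlo hlo1
    nlinarith [sq_nonneg lo]
  have hu1 : 1 - (1 - w) * lo ^ 2 ≤ 1 := by nlinarith [sq_nonneg lo]
  have hv0 : 0 ≤ 1 - (1 - w) * hi ^ 2 := by
    have : hi ^ 2 ≤ 1 := pow_le_one₀ hhi hhi1
    nlinarith [sq_nonneg hi]
  have hv1 : 1 - (1 - w) * hi ^ 2 ≤ 1 := by nlinarith [sq_nonneg hi]
  have key : ∀ ℬ : Finset (Finset E), ℬ ⊆ 𝒜.filter (f ∈ ·) →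
      Y (𝒜₀ ∪ ℬ) P' ≤ (1 - (1 - w) * lo ^ 2) ^ (ℬ.filter G).card * Y 𝒜₀ P' ∧
      (1 - (1 - w) * hi ^ 2) ^ (ℬ.filter G).card * (1 - lam) ^ (ℬ.filter fun t => ¬ G t).card
        * Y 𝒜₀ P' ≤ Y (𝒜₀ ∪ ℬ) P' := by
    intro ℬ
    induction ℬ using Finset.induction_on with
    | empty => intro _; simp
    | insert t ℬ htℬ ih =>
      intro hsub
      obtain ⟨ih1, ih2⟩ := ih ((Finset.subset_insert _ _).trans hsub)
      obtain ⟨ht𝒜, hft⟩ := Finset.mem_filter.1 (hsub (Finset.mem_insert_self _ _))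
      have hsubℬ : 𝒜₀ ∪ ℬ ⊆ 𝒜 := Finset.union_subset (Finset.filter_subset _ _)
        ((Finset.subset_insert _ _).trans hsub |>.trans (Finset.filter_subset _ _))
      have htn : t ∉ 𝒜₀ ∪ ℬ := by simp [h𝒜₀, htℬ, hft]
      have hrec : Y (𝒜₀ ∪ insert t ℬ) P'
          = Y (𝒜₀ ∪ ℬ) P' - (1 - w) * Y (𝒜₀ ∪ ℬ) (P' ∪ t) := by
        rw [Finset.union_insert]; exact pinnedSum_insert htn P'
      by_cases hg : G t
      · have hgen := hg
        obtain ⟨hdis, huniq⟩ := hg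
        have hcard := hT.uniform t (h𝒜 ht𝒜)
        obtain ⟨a, b, hab, hte⟩ : ∃ a b, a ≠ b ∧ t.erase f = {a, b} := by
          rw [← Finset.card_eq_two, Finset.card_erase_of_mem hft, hcard]
        have ha : a ∈ t ∧ a ≠ f := by
          have : a ∈ t.erase f := by simp [hte]
          exact ⟨Finset.mem_of_mem_erase this, Finset.ne_of_mem_erase this⟩
        have hb : b ∈ t ∧ b ≠ f := by
          have : b ∈ t.erase f := by simp [hte]
          exact ⟨Finset.mem_of_mem_erase this, Finset.ne_of_mem_erase this⟩
        have htP : P' ∪ t = insert b (insert a P') := by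
          rw [← Finset.insert_erase hft, hte, hP']
          ext x; simp only [Finset.mem_union, Finset.mem_insert, Finset.mem_singleton]; tauto
        have hPt : P ∪ t = insert b (insert a P') := by
          rw [← htP, hP']
          ext x; simp only [Finset.mem_union, Finset.mem_insert]
          constructor
          · tauto
          · rintro ((rfl | h) | h) <;> tauto
        have hdis' := Finset.disjoint_left.1 hdis
        have haP : a ∉ P' := by simp [hP', ha.2, hdis' ha.1]
        have hbP : b ∉ insert a P' := by simp [hP', hb.2, hdis' hb.1, hab.symm]
        have hact' : ∀ s ∈ T, Disjoint s P' → s ∈ 𝒜₀ ∪ ℬ := by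
          intro s hs hsd
          rw [hP', Finset.disjoint_insert_right] at hsd
          exact Finset.mem_union_left _ (Finset.mem_filter.2 ⟨hact s hs hsd.2, hsd.1⟩)
        have hnd2 : ∀ s ∈ 𝒜₀ ∪ ℬ, ¬ s ⊆ insert b (insert a P') := by
          intro s hs hsub
          rw [← hPt] at hsub
          exact htn (huniq s (hsubℬ hs) hsub ▸ hs)
        have hPc : P'.card ≤ D + 1 := by
          rw [hP', Finset.card_insert_of_notMem hf]; omega
        have hPc2 : (insert a P').card ≤ D + 2 := by
          rw [Finset.card_insert_of_notMem haP]; omega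
        obtain ⟨hA1, hA2⟩ := h _ (hsubℬ.trans h𝒜) P' (by omega) hact' a haP
          fun s hs hsub => hnd2 s hs (hsub.trans (Finset.subset_insert _ _))
        obtain ⟨hB1, hB2⟩ := h _ (hsubℬ.trans h𝒜) (insert a P') hPc2
          (fun s hs hd => hact' s hs (hd.mono_right (Finset.subset_insert _ _))) b hbP hnd2
        have hlow : lo ^ 2 * Y (𝒜₀ ∪ ℬ) P' ≤ Y (𝒜₀ ∪ ℬ) (P' ∪ t) := by
          rw [htP]
          calc lo ^ 2 * Y (𝒜₀ ∪ ℬ) P' = lo * (lo * Y (𝒜₀ ∪ ℬ) P') := by ring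
            _ ≤ lo * Y (𝒜₀ ∪ ℬ) (insert a P') := mul_le_mul_of_nonneg_left hA1 hlo
            _ ≤ _ := hB1
        have hupp : Y (𝒜₀ ∪ ℬ) (P' ∪ t) ≤ hi ^ 2 * Y (𝒜₀ ∪ ℬ) P' := by
          rw [htP]
          calc Y (𝒜₀ ∪ ℬ) (insert b (insert a P')) ≤ hi * Y (𝒜₀ ∪ ℬ) (insert a P') := hB2
            _ ≤ hi * (hi * Y (𝒜₀ ∪ ℬ) P') := mul_le_mul_of_nonneg_left hA2 hhi
            _ = _ := by ring
        rw [Finset.filter_insert, if_pos hgen, Finset.card_insert_of_notMem (by simp [htℬ]),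
          Finset.filter_insert, if_neg (not_not.2 hgen), hrec]
        constructor
        · calc Y (𝒜₀ ∪ ℬ) P' - (1 - w) * Y (𝒜₀ ∪ ℬ) (P' ∪ t)
              ≤ (1 - (1 - w) * lo ^ 2) * Y (𝒜₀ ∪ ℬ) P' := by nlinarith
            _ ≤ (1 - (1 - w) * lo ^ 2) * _ := mul_le_mul_of_nonneg_left ih1 hu0
            _ = _ := by rw [pow_succ]; ring
        · calc _ = (1 - (1 - w) * hi ^ 2) * ((1 - (1 - w) * hi ^ 2) ^ (ℬ.filter G).card *
                (1 - lam) ^ (ℬ.filter fun t => ¬ G t).card * Y 𝒜₀ P') := by rw [pow_succ]; ring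
            _ ≤ (1 - (1 - w) * hi ^ 2) * Y (𝒜₀ ∪ ℬ) P' := mul_le_mul_of_nonneg_left ih2 hv0
            _ ≤ _ := by nlinarith
      · obtain ⟨g, hgt, hgP⟩ := Finset.not_subset.1 (hnd t ht𝒜)
        have hupp : Y (𝒜₀ ∪ ℬ) (P' ∪ t) ≤ lam * Y (𝒜₀ ∪ ℬ) P' := by
          refine le_trans (pinnedSum_anti_right hl hw _ (P := insert g P') ?_)
            (pinnedSum_insert_le hl hw hw1 _ hgP)
          exact Finset.insert_subset (Finset.mem_union_right _ hgt) Finset.subset_union_left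
        have hnn := hYnn (𝒜₀ ∪ ℬ) (P' ∪ t)
        rw [Finset.filter_insert, if_neg hg, Finset.filter_insert, if_pos hg,
          Finset.card_insert_of_notMem (by simp [htℬ]), hrec]
        constructor
        · nlinarith
        · calc _ = (1 - lam) * ((1 - (1 - w) * hi ^ 2) ^ (ℬ.filter G).card *
                (1 - lam) ^ (ℬ.filter fun t => ¬ G t).card * Y 𝒜₀ P') := by rw [pow_succ]; ring
            _ ≤ (1 - lam) * Y (𝒜₀ ∪ ℬ) P' := mul_le_mul_of_nonneg_left ih2 (by linarith)
            _ ≤ _ := by nlinarith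
  have hun : 𝒜₀ ∪ 𝒜.filter (f ∈ ·) = 𝒜 := by
    rw [h𝒜₀, Finset.union_comm]; exact Finset.filter_union_filter_not_eq _ _
  obtain ⟨k1, k2⟩ := key _ (Finset.Subset.refl _)
  rw [hun] at k1 k2
  have hsplit : Y 𝒜₀ P' = lam * (Y 𝒜 P - Y 𝒜 P') := pinnedSum_filter_insert 𝒜 hf
  have hgoodeq : ((𝒜.filter (f ∈ ·)).filter G).card = (T.filter fun t => f ∈ t ∧ G t).card := by
    congr 1
    ext t
    simp only [Finset.mem_filter]
    constructor
    · rintro ⟨⟨h1, h2⟩, h3⟩; exact ⟨h𝒜 h1, h2, h3⟩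
    · rintro ⟨h1, h2, h3⟩; exact ⟨⟨hact t h1 h3.1, h2⟩, h3⟩
  have htot : (T.filter fun t => f ∈ t ∧ G t).card + (T.filter fun t => f ∈ t ∧ ¬ G t).card
      = n - 2 := by
    rw [← hT.regular f, ← Finset.card_filter_add_card_filter_not (s := T.filter (f ∈ ·)) G,
      Finset.filter_filter, Finset.filter_filter]
  have hbad' : ((𝒜.filter (f ∈ ·)).filter fun t => ¬ G t).card ≤ K := by
    refine le_trans (Finset.card_le_card ?_) hbad
    intro t
    simp only [Finset.mem_filter]
    rintro ⟨⟨h1, h2⟩, h3⟩; exact ⟨h𝒜 h1, h2, h3⟩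
  have hnn0 := hYnn 𝒜₀ P'
  have hnnP' := hYnn 𝒜 P'
  have hnnP := hYnn 𝒜 P
  constructor
  · set ρ := (1 - (1 - w) * hi ^ 2) ^ (n - 2) * (1 - lam) ^ K with hρ
    have hρ0 : 0 ≤ ρ := mul_nonneg (pow_nonneg hv0 _) (pow_nonneg (by linarith) _)
    have hρ1 : ρ ≤ 1 := mul_le_one₀ (pow_le_one₀ hv0 hv1) (pow_nonneg (by linarith) _)
      (pow_le_one₀ (by linarith) (by linarith))
    have h3 : ρ * Y 𝒜₀ P' ≤ Y 𝒜 P' := by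
      refine le_trans (mul_le_mul_of_nonneg_right ?_ hnn0) k2
      exact mul_le_mul (pow_le_pow_of_le_one hv0 hv1 (by omega))
        (pow_le_pow_of_le_one (by linarith) (by linarith) hbad')
        (pow_nonneg (by linarith) _) (pow_nonneg hv0 _)
    rw [hsplit] at h3
    change lam / (1 + lam) * ρ * Y 𝒜 P ≤ Y 𝒜 P'
    rw [div_mul_eq_mul_div, div_mul_eq_mul_div, div_le_iff₀ (by linarith)]
    nlinarith [mul_nonneg (mul_nonneg hl hnnP') (sub_nonneg.2 hρ1)]
  · have h3 : Y 𝒜 P' ≤ (1 - (1 - w) * lo ^ 2) ^ (n - 2 - K) * Y 𝒜₀ P' := by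
      refine le_trans k1 (mul_le_mul_of_nonneg_right ?_ hnn0)
      exact pow_le_pow_of_le_one hu0 hu1 (by rw [hgoodeq]; omega)
    rw [hsplit] at h3
    change Y 𝒜 P' ≤ lam * (1 - (1 - w) * lo ^ 2) ^ (n - 2 - K) * Y 𝒜 P
    have := mul_nonneg (pow_nonneg hu0 (n - 2 - K)) (mul_nonneg hl hnnP')
    nlinarith

end PinnedSum

section OccupationLimit

open Topology

lemma tendsto_one_add_pow_sub_exp {g : ℕ → ℝ} {t : ℝ}
    (hg : Tendsto (fun n : ℕ => n * g n) atTop (𝓝 t)) (K : ℕ) :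
    Tendsto (fun n : ℕ => (1 + g n) ^ (n - K)) atTop (𝓝 (Real.exp t)) := by
  have h0 : Tendsto g atTop (𝓝 0) := by
    have := hg.mul (tendsto_inv_atTop_nhds_zero_nat (𝕜 := ℝ))
    rw [mul_zero] at this
    refine this.congr' ?_
    filter_upwards [eventually_gt_atTop 0] with n hn
    have : (n : ℝ) ≠ 0 := by positivity
    field_simp
  have h1 : Tendsto (fun n => (1 + g n) ^ K) atTop (𝓝 1) := by
    simpa using (h0.const_add 1).pow K
  have h2 := (Real.tendsto_one_add_pow_exp_of_tendsto hg).div h1 one_ne_zero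
  rw [div_one] at h2
  refine h2.congr' ?_
  have hpos : ∀ᶠ n in atTop, -1 < g n := h0.eventually (lt_mem_nhds (by norm_num))
  filter_upwards [hpos, eventually_ge_atTop K] with n hn hK
  have : (1 + g n) ≠ 0 := by linarith
  rw [Pi.div_apply, pow_sub₀ _ this hK, div_eq_mul_inv]

lemma tendsto_div_sqrt_nat (c : ℝ) : Tendsto (fun n : ℕ => c / √(n : ℝ)) atTop (𝓝 0) :=
  Tendsto.div_atTop tendsto_const_nhds
    (Real.tendsto_sqrt_atTop.comp tendsto_natCast_atTop_atTop)

variable {E : ℕ → Type*} [∀ n, Fintype (E n)]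

/-- Asymptotic bounds `l / √n` and `u / √n` for the occupation probabilities at activity
`c / √n`, robust under pinning of boundedly many elements. -/
def HasOccLimits (T : ∀ n, Finset (Finset (E n))) (c w l u : ℝ) : Prop :=
  ∀ D : ℕ, ∃ lo hi : ℕ → ℝ,
    Tendsto (fun n : ℕ => √(n : ℝ) * lo n) atTop (𝓝 l) ∧
    Tendsto (fun n : ℕ => √(n : ℝ) * hi n) atTop (𝓝 u) ∧
    ∀ᶠ n : ℕ in atTop, OccBounds (T n) (c / √(n : ℝ)) w D (lo n) (hi n)

variable {T : ∀ n, Finset (Finset (E n))} {c w : ℝ}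

lemma hasOccLimits_zero (T : ∀ n, Finset (Finset (E n))) (hc : 0 ≤ c) (hw : 0 ≤ w) (hw1 : w ≤ 1) :
    HasOccLimits T c w 0 c := by
  intro D
  refine ⟨fun _ => 0, fun n => c / √(n : ℝ), by simp, ?_, ?_⟩
  · refine tendsto_const_nhds.congr' ?_
    filter_upwards [eventually_gt_atTop 0] with n hn
    have : √(n : ℝ) ≠ 0 := by positivity
    field_simp
  · exact Eventually.of_forall fun n => occBounds_zero (by positivity) hw hw1 _ _

lemma tendsto_of_sqrt_mul {a : ℕ → ℝ} {l : ℝ}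
    (h : Tendsto (fun n : ℕ => √(n : ℝ) * a n) atTop (𝓝 l)) : Tendsto a atTop (𝓝 0) := by
  have := h.mul (tendsto_div_sqrt_nat 1)
  rw [mul_zero] at this
  refine this.congr' ?_
  filter_upwards [eventually_gt_atTop 0] with n hn
  have : √(n : ℝ) ≠ 0 := by positivity
  field_simp

lemma OccBounds.max_zero {E : Type*} [Fintype E] {T : Finset (Finset E)} {lam w : ℝ} {D : ℕ}
    {lo hi : ℝ} (hl : 0 ≤ lam) (hw : 0 ≤ w) (h : OccBounds T lam w D lo hi) :
    OccBounds T lam w D (max lo 0) (max hi 0) := by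
  intro 𝒜 h𝒜 P hP hact f hf hnd
  obtain ⟨h1, h2⟩ := h 𝒜 h𝒜 P hP hact f hf hnd
  have h3 := pinnedSum_nonneg hl hw 𝒜 P
  have h4 := pinnedSum_nonneg hl hw 𝒜 (insert f P)
  refine ⟨?_, h2.trans (mul_le_mul_of_nonneg_right (le_max_left _ _) h3)⟩
  rcases max_cases lo 0 with h | h
  · rw [h.1]; exact h1
  · rw [h.1, zero_mul]; exact h4

lemma HasOccLimits.step (hT : ∀ n, IsTriangleSystem (T n) n) (hc : 0 ≤ c) (hw : 0 ≤ w)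
    (hw1 : w ≤ 1) {l u : ℝ} (hl : 0 ≤ l) (hu : 0 ≤ u) (h : HasOccLimits T c w l u) :
    HasOccLimits T c w (c * Real.exp (-((1 - w) * u ^ 2))) (c * Real.exp (-((1 - w) * l ^ 2))) := by
  intro D
  obtain ⟨lo', hi', hlo', hhi', hB'⟩ := h (D + 2)
  set lo := fun n => max (lo' n) 0
  set hi := fun n => max (hi' n) 0
  have hpush : ∀ (a : ℕ → ℝ) (l : ℝ), 0 ≤ l → Tendsto (fun n : ℕ => √(n : ℝ) * a n) atTop (𝓝 l) →
      Tendsto (fun n : ℕ => √(n : ℝ) * max (a n) 0) atTop (𝓝 l) := by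
    intro a l hl ha
    have := ha.max (tendsto_const_nhds (x := (0 : ℝ)))
    rw [max_eq_left hl] at this
    refine this.congr fun n => ?_
    rw [mul_max_of_nonneg _ _ (Real.sqrt_nonneg _), mul_zero]
  have hlo : Tendsto (fun n : ℕ => √(n : ℝ) * lo n) atTop (𝓝 l) := hpush _ _ hl hlo'
  have hhi : Tendsto (fun n : ℕ => √(n : ℝ) * hi n) atTop (𝓝 u) := hpush _ _ hu hhi'
  have hexp : ∀ (a : ℕ → ℝ) (l : ℝ) (K : ℕ), Tendsto (fun n : ℕ => √(n : ℝ) * a n) atTop (𝓝 l) →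
      Tendsto (fun n : ℕ => (1 - (1 - w) * a n ^ 2) ^ (n - K)) atTop
        (𝓝 (Real.exp (-((1 - w) * l ^ 2)))) := by
    intro a l K ha
    have : Tendsto (fun n : ℕ => (n : ℝ) * (-((1 - w) * a n ^ 2))) atTop
        (𝓝 (-((1 - w) * l ^ 2))) := by
      refine (((ha.pow 2).const_mul (1 - w)).neg).congr fun n => ?_
      rw [mul_pow, Real.sq_sqrt (Nat.cast_nonneg n)]; ring
    refine (tendsto_one_add_pow_sub_exp this K).congr fun n => ?_
    rw [← sub_eq_add_neg]
  set lam : ℕ → ℝ := fun n => c / √(n : ℝ) with hlam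
  have hlam0 : Tendsto lam atTop (𝓝 0) := tendsto_div_sqrt_nat c
  have hlamc : Tendsto (fun n : ℕ => √(n : ℝ) * lam n) atTop (𝓝 c) := by
    refine tendsto_const_nhds.congr' ?_
    filter_upwards [eventually_gt_atTop 0] with n hn
    have : √(n : ℝ) ≠ 0 := by positivity
    simp only [hlam]
    field_simp
  refine ⟨fun n => lam n / (1 + lam n) * ((1 - (1 - w) * hi n ^ 2) ^ (n - 2) *
      (1 - lam n) ^ (D + 3 * D ^ 2)),
    fun n => lam n * (1 - (1 - w) * lo n ^ 2) ^ (n - 2 - (D + 3 * D ^ 2)), ?_, ?_, ?_⟩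
  · have h1 := (hlamc.div (hlam0.const_add 1) (by norm_num)).mul
      ((hexp hi u 2 hhi).mul ((hlam0.const_sub 1).pow (D + 3 * D ^ 2)))
    simp only [add_zero, div_one, sub_zero, one_pow, mul_one] at h1
    refine h1.congr fun n => ?_
    simp only [Pi.div_apply]
    ring
  · refine (hlamc.mul (hexp lo l (2 + (D + 3 * D ^ 2)) hlo)).congr fun n => ?_
    rw [mul_assoc, ← Nat.sub_sub]
  · have e1 : ∀ᶠ n in atTop, lam n < 1 := hlam0.eventually (gt_mem_nhds one_pos)
    have e2 : ∀ᶠ n in atTop, lo n < 1 := (tendsto_of_sqrt_mul hlo).eventually (gt_mem_nhds one_pos)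
    have e3 : ∀ᶠ n in atTop, hi n < 1 := (tendsto_of_sqrt_mul hhi).eventually (gt_mem_nhds one_pos)
    filter_upwards [e1, e2, e3, hB'] with n h1 h2 h3 hB
    have hl0 : 0 ≤ lam n := by positivity
    exact (hB.max_zero hl0 hw).step (hT n) hl0 h1.le hw hw1 (le_max_right _ _) h2.le
      (le_max_right _ _) h3.le

/-- The activity (times `√n`) at which the edge density (times `√n`) equals `x`. -/
def activity (w x : ℝ) : ℝ := x * Real.exp ((1 - w) * x ^ 2)

lemma hasOccLimits_activity (hT : ∀ n, IsTriangleSystem (T n) n) (hw : 0 ≤ w) (hw1 : w ≤ 1)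
    {x : ℝ} (hx : 0 ≤ x) (hc : activity w x ≤ 1 / 2) {ε : ℝ} (hε : 0 < ε) :
    ∃ l u, x - ε ≤ l ∧ u ≤ x + ε ∧ HasOccLimits T (activity w x) w l u := by
  set c := activity w x with hcdef
  have hc0 : 0 ≤ c := by rw [hcdef, activity]; positivity
  have hz : 0 ≤ 1 - w := by linarith
  have hxc : x ≤ c := le_mul_of_one_le_right hx (Real.one_le_exp (by positivity))
  have hfix : c * Real.exp (-((1 - w) * x ^ 2)) = x := by
    rw [hcdef, activity, mul_assoc, ← Real.exp_add]; simp
  have key : ∀ k : ℕ, ∃ l u, 0 ≤ l ∧ l ≤ x ∧ x ≤ u ∧ u ≤ c ∧ x - l ≤ (1 / 2) ^ k ∧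
      u - x ≤ (1 / 2) ^ k ∧ HasOccLimits T c w l u := by
    intro k
    induction k with
    | zero => exact ⟨0, c, le_rfl, hx, hxc, le_rfl, by norm_num; linarith, by norm_num; linarith,
        hasOccLimits_zero T hc0 hw hw1⟩
    | succ k ih =>
      obtain ⟨l, u, hl, hlx, hxu, huc, h1, h2, h⟩ := ih
      have hlip : ∀ a b : ℝ, 0 ≤ a → a ≤ b → b ≤ 1 / 2 →
          Real.exp (-((1 - w) * a ^ 2)) - Real.exp (-((1 - w) * b ^ 2)) ≤ b - a := by
        intro a b ha hab hb
        have h3 : Real.exp (-((1 - w) * a ^ 2)) ≤ 1 := Real.exp_le_one_iff.2 (by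
          have := mul_nonneg hz (sq_nonneg a); linarith)
        have h4 : Real.exp (-((1 - w) * b ^ 2)) = Real.exp (-((1 - w) * a ^ 2)) *
          Real.exp (-((1 - w) * (b ^ 2 - a ^ 2))) := by rw [← Real.exp_add]; congr 1; ring
        have h5 := Real.add_one_le_exp (-((1 - w) * (b ^ 2 - a ^ 2)))
        have h6 : (1 - w) * (b ^ 2 - a ^ 2) ≤ b - a := by
          have : b ^ 2 - a ^ 2 ≤ b - a := by nlinarith
          have h7 : 0 ≤ b ^ 2 - a ^ 2 := by nlinarith
          nlinarith
        have h8 : 0 < Real.exp (-((1 - w) * a ^ 2)) := Real.exp_pos _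
        rw [h4]
        nlinarith
      have hmono : ∀ a b : ℝ, 0 ≤ a → a ≤ b →
          Real.exp (-((1 - w) * b ^ 2)) ≤ Real.exp (-((1 - w) * a ^ 2)) := by
        intro a b ha hab
        refine Real.exp_le_exp.2 (neg_le_neg (mul_le_mul_of_nonneg_left ?_ hz))
        exact pow_le_pow_left₀ ha hab 2
      refine ⟨_, _, by positivity, ?_, ?_, ?_, ?_, ?_, h.step hT hc0 hw hw1 hl (hx.trans hxu)⟩
      · calc _ ≤ c * Real.exp (-((1 - w) * x ^ 2)) :=
            mul_le_mul_of_nonneg_left (hmono x u hx hxu) hc0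
          _ = x := hfix
      · calc x = c * Real.exp (-((1 - w) * x ^ 2)) := hfix.symm
          _ ≤ _ := mul_le_mul_of_nonneg_left (hmono l x hl hlx) hc0
      · refine mul_le_of_le_one_right hc0 (Real.exp_le_one_iff.2 ?_)
        have := mul_nonneg hz (sq_nonneg l); linarith
      · have := hlip x u hx hxu (huc.trans hc)
        have h3 := mul_le_mul_of_nonneg_left this hc0
        rw [mul_sub, hfix] at h3
        have h4 := mul_le_mul_of_nonneg_right hc (sub_nonneg.2 hxu)
        have h5 : (1 / 2 : ℝ) ^ (k + 1) = (1 / 2) ^ k * (1 / 2) := pow_succ _ _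
        linarith
      · have := hlip l x hl hlx (hxc.trans hc)
        have h3 := mul_le_mul_of_nonneg_left this hc0
        rw [mul_sub, hfix] at h3
        have h4 := mul_le_mul_of_nonneg_right hc (sub_nonneg.2 hlx)
        have h5 : (1 / 2 : ℝ) ^ (k + 1) = (1 / 2) ^ k * (1 / 2) := pow_succ _ _
        linarith
  obtain ⟨k, hk⟩ := exists_pow_lt_of_lt_one hε (show (1 / 2 : ℝ) < 1 by norm_num)
  obtain ⟨l, u, -, -, -, -, h1, h2, h⟩ := key k
  exact ⟨l, u, by linarith, by linarith, h⟩

/-- Occupation probabilities are asymptotic to `x / √n`. -/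
lemma eventually_pinnedSum_singleton (hT : ∀ n, IsTriangleSystem (T n) n) (hw : 0 ≤ w)
    (hw1 : w ≤ 1) {x : ℝ} (hx : 0 ≤ x) (hc : activity w x ≤ 1 / 2) {ε : ℝ} (hε : 0 < ε) :
    ∀ᶠ n : ℕ in atTop, ∀ e : E n,
      (x - ε) / √(n : ℝ) * pinnedSum (activity w x / √(n : ℝ)) w (T n) ∅
        ≤ pinnedSum (activity w x / √(n : ℝ)) w (T n) {e} ∧
      pinnedSum (activity w x / √(n : ℝ)) w (T n) {e}
        ≤ (x + ε) / √(n : ℝ) * pinnedSum (activity w x / √(n : ℝ)) w (T n) ∅ := by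
  obtain ⟨l, u, hl, hu, h⟩ := hasOccLimits_activity hT hw hw1 hx hc (half_pos hε)
  obtain ⟨lo, hi, hlo, hhi, hB⟩ := h 0
  have e1 : ∀ᶠ n : ℕ in atTop, x - ε < √(n : ℝ) * lo n :=
    hlo.eventually (lt_mem_nhds (by linarith))
  have e2 : ∀ᶠ n : ℕ in atTop, √(n : ℝ) * hi n < x + ε :=
    hhi.eventually (gt_mem_nhds (by linarith))
  filter_upwards [e1, e2, hB, eventually_gt_atTop 0] with n h1 h2 hB hn e
  have hs : 0 < √(n : ℝ) := by positivity
  have hlam : 0 ≤ activity w x / √(n : ℝ) := by rw [activity]; positivity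
  have hnn := pinnedSum_nonneg hlam hw (T n) ∅
  obtain ⟨h3, h4⟩ := hB (T n) (Finset.Subset.refl _) ∅ (by simp) (fun t ht _ => ht) e (by simp)
    (by
      intro t ht hsub
      have := Finset.card_le_card hsub
      rw [(hT n).uniform t ht] at this
      simp at this)
  rw [show (insert e ∅ : Finset (E n)) = {e} from rfl] at h3 h4
  refine ⟨le_trans (mul_le_mul_of_nonneg_right ?_ hnn) h3,
    h4.trans (mul_le_mul_of_nonneg_right ?_ hnn)⟩
  · rw [div_le_iff₀ hs]; linarith
  · rw [le_div_iff₀ hs]; linarith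

end OccupationLimit

section PartitionFunction

open Topology

/-- The partition function `∑_U λ^{|U|} w^{#{t ∈ T : t ⊆ U}}`. -/
def partFun {E : Type*} [Fintype E] (T : Finset (Finset E)) (w lam : ℝ) : ℝ :=
  ∑ U : Finset E, lam ^ U.card * w ^ containedCount T U

section Basic

variable {E : Type*} [Fintype E] {T : Finset (Finset E)} {w lam : ℝ}

lemma pinnedSum_empty (lam w : ℝ) (T : Finset (Finset E)) :
    pinnedSum lam w T ∅ = partFun T w lam := by
  simp [pinnedSum, partFun]

lemma one_le_partFun {n : ℕ} (hT : IsTriangleSystem T n) (hl : 0 ≤ lam) (hw : 0 ≤ w) :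
    1 ≤ partFun T w lam := by
  have h0 : containedCount T ∅ = 0 := hT.containedCount_empty
  calc (1 : ℝ) = lam ^ (∅ : Finset E).card * w ^ containedCount T ∅ := by simp [h0]
    _ ≤ _ := Finset.single_le_sum (f := fun U : Finset E => lam ^ U.card * w ^ containedCount T U)
        (fun U _ => by positivity) (Finset.mem_univ _)

/-- The derivative of the partition function in the activity. -/
def partFunDeriv (T : Finset (Finset E)) (w lam : ℝ) : ℝ :=
  ∑ U : Finset E, (U.card * lam ^ (U.card - 1)) * w ^ containedCount T U

lemma hasDerivAt_partFun (T : Finset (Finset E)) (w lam : ℝ) :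
    HasDerivAt (partFun T w) (partFunDeriv T w lam) lam := by
  unfold partFun partFunDeriv
  exact HasDerivAt.fun_sum fun U _ => (hasDerivAt_pow U.card lam).mul_const _

lemma partFunDeriv_nonneg (T : Finset (Finset E)) (hl : 0 ≤ lam) (hw : 0 ≤ w) :
    0 ≤ partFunDeriv T w lam :=
  Finset.sum_nonneg fun _ _ => by positivity

lemma mul_partFunDeriv (T : Finset (Finset E)) (w lam : ℝ) :
    lam * partFunDeriv T w lam = ∑ e : E, pinnedSum lam w T {e} := by
  unfold partFunDeriv pinnedSum
  simp_rw [Finset.sum_filter, Finset.singleton_subset_iff]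
  rw [Finset.sum_comm, Finset.mul_sum]
  refine Finset.sum_congr rfl fun U _ => ?_
  rw [← Finset.sum_filter, Finset.sum_const, Finset.filter_univ_mem, nsmul_eq_mul]
  rcases Nat.eq_zero_or_pos U.card with h | h
  · simp [h]
  · conv_rhs => rw [show U.card = U.card - 1 + 1 by omega, pow_succ]
    rw [show U.card - 1 + 1 = U.card by omega]
    ring

lemma mul_partFunDeriv_le {n : ℕ} (hT : IsTriangleSystem T n) (hl : 0 ≤ lam) (hw : 0 ≤ w)
    (hw1 : w ≤ 1) : lam * partFunDeriv T w lam ≤ (n.choose 2 : ℝ) * (lam * partFun T w lam) := by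
  rw [mul_partFunDeriv]
  refine (Finset.sum_le_card_nsmul _ _ (lam * partFun T w lam) fun e _ => ?_).trans ?_
  · rw [← pinnedSum_empty]
    exact pinnedSum_insert_le (P := ∅) hl hw hw1 T (by simp)
  · rw [Finset.card_univ, hT.card_elements, nsmul_eq_mul]

end Basic

/-- The normalisation `n^{3/2}`. -/
def scale (n : ℕ) : ℝ := (n : ℝ) ^ ((3 : ℝ) / 2)

lemma scale_eq (n : ℕ) : scale n = n * √(n : ℝ) := by
  unfold scale
  rw [show (3 : ℝ) / 2 = 1 + 1 / 2 by norm_num, Real.sqrt_eq_rpow]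
  rcases Nat.eq_zero_or_pos n with rfl | hn
  · norm_num
  · rw [Real.rpow_add (by positivity), Real.rpow_one]

lemma scale_pos {n : ℕ} (hn : 0 < n) : 0 < scale n := by unfold scale; positivity

lemma scale_nonneg (n : ℕ) : 0 ≤ scale n := by unfold scale; positivity

lemma tendsto_scale : Tendsto scale atTop atTop :=
  (tendsto_rpow_atTop (by norm_num)).comp tendsto_natCast_atTop_atTop

lemma choose_two_div (n : ℕ) (hn : 0 < n) :
    (n.choose 2 : ℝ) / √(n : ℝ) / scale n = 1 / 2 * (1 - 1 / (n : ℝ)) := by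
  have h : (0 : ℝ) < √(n : ℝ) := by positivity
  have h2 : (n : ℝ) ≠ 0 := by positivity
  rw [scale_eq, div_div, show √(n : ℝ) * (n * √(n : ℝ)) = n * (√(n : ℝ) * √(n : ℝ)) by ring,
    Real.mul_self_sqrt (Nat.cast_nonneg n), Nat.cast_choose_two]
  field_simp

lemma tendsto_choose_two_div :
    Tendsto (fun n : ℕ => (n.choose 2 : ℝ) / √(n : ℝ) / scale n) atTop (𝓝 (1 / 2)) := by
  have : Tendsto (fun n : ℕ => 1 / 2 * (1 - 1 / (n : ℝ))) atTop (𝓝 (1 / 2 * (1 - 0))) :=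
    (tendsto_one_div_atTop_nhds_zero_nat.const_sub 1).const_mul _
  rw [sub_zero, mul_one] at this
  refine this.congr' ?_
  filter_upwards [eventually_gt_atTop 0] with n hn
  rw [choose_two_div n hn]

lemma activity_le_half {w x : ℝ} (hw : 0 ≤ w) (hx : 0 ≤ x) (hx1 : x ≤ 1 / 4) :
    activity w x ≤ 1 / 2 := by
  unfold activity
  have h1 : (1 - w) * x ^ 2 ≤ 1 / 2 := by nlinarith
  have h2 : Real.exp (1 / 2) ≤ 2 := by
    have h3 : Real.exp (1 / 2) * Real.exp (1 / 2) = Real.exp 1 := by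
      rw [← Real.exp_add]; norm_num
    have := Real.exp_one_lt_d9
    nlinarith [Real.exp_pos (1 / 2)]
  have h4 := (Real.exp_le_exp.2 h1).trans h2
  nlinarith [Real.exp_pos ((1 - w) * x ^ 2)]

lemma activity_nonneg {w x : ℝ} (hx : 0 ≤ x) : 0 ≤ activity w x := by
  unfold activity; positivity

lemma hasDerivAt_activity (w x : ℝ) :
    HasDerivAt (activity w) (Real.exp ((1 - w) * x ^ 2) * (1 + 2 * (1 - w) * x ^ 2)) x := by
  have h1 : HasDerivAt (fun x : ℝ => (1 - w) * x ^ 2) ((1 - w) * (2 * x)) x := by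
    simpa using (hasDerivAt_pow 2 x).const_mul (1 - w)
  refine ((hasDerivAt_id x).mul h1.exp).congr_deriv ?_
  simp only [id]; ring

variable {E : ℕ → Type*} [∀ n, Fintype (E n)] {T : ∀ n, Finset (Finset (E n))} {w : ℝ}

lemma tendsto_logPartFun_deriv (hT : ∀ n, IsTriangleSystem (T n) n) (hw : 0 ≤ w)
    (hw1 : w ≤ 1) {x : ℝ} (hx : 0 < x) (hx1 : x ≤ 1 / 4) :
    Tendsto (fun n : ℕ => partFunDeriv (T n) w (activity w x / √(n : ℝ)) *
        (Real.exp ((1 - w) * x ^ 2) * (1 + 2 * (1 - w) * x ^ 2) / √(n : ℝ)) /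
        partFun (T n) w (activity w x / √(n : ℝ)) / scale n) atTop
      (𝓝 (1 / 2 + (1 - w) * x ^ 2)) := by
  have hocc : Tendsto (fun n : ℕ => activity w x / √(n : ℝ) *
      partFunDeriv (T n) w (activity w x / √(n : ℝ)) /
        partFun (T n) w (activity w x / √(n : ℝ)) / scale n) atTop (𝓝 (x / 2)) := by
    rw [Metric.tendsto_atTop']
    intro ε hε
    have hev := eventually_pinnedSum_singleton hT hw hw1 hx.le
      (activity_le_half hw hx.le hx1) hε
    have hclose : ∀ᶠ n : ℕ in atTop,
        |x * ((n.choose 2 : ℝ) / √(n : ℝ) / scale n) - x / 2| < ε / 2 := by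
      have := tendsto_choose_two_div.const_mul x
      rw [mul_one_div] at this
      exact (Metric.tendsto_nhds.1 this (ε / 2) (half_pos hε)).mono fun n hn => by
        rwa [Real.dist_eq] at hn
    obtain ⟨N, hN⟩ := eventually_atTop.1 (hev.and (hclose.and (eventually_gt_atTop 0)))
    refine ⟨N, fun n hn => ?_⟩
    obtain ⟨h1, h2, hn0⟩ := hN n hn.le
    have hZ := one_le_partFun (hT n) (lam := activity w x / √(n : ℝ)) (w := w)
      (div_nonneg (activity_nonneg hx.le) (Real.sqrt_nonneg _)) hw
    have hv := scale_pos hn0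
    rw [mul_partFunDeriv]
    simp only [pinnedSum_empty] at h1
    set Z := partFun (T n) w (activity w x / √(n : ℝ)) with hZdef
    set M := (n.choose 2 : ℝ) / √(n : ℝ) / scale n with hM
    have hM1 : M ≤ 1 / 2 := by
      rw [hM, choose_two_div n hn0]
      have : (0 : ℝ) ≤ 1 / n := by positivity
      linarith
    have hM0 : 0 ≤ M := by positivity
    have hup : (∑ e : E n, pinnedSum (activity w x / √(n : ℝ)) w (T n) {e}) / Z / scale n
        ≤ (x + ε) * M := by
      rw [div_le_iff₀ hv, div_le_iff₀ (by linarith)]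
      refine (Finset.sum_le_card_nsmul _ _ _ fun e _ => (h1 e).2).trans_eq ?_
      rw [Finset.card_univ, (hT n).card_elements, nsmul_eq_mul, hM]
      field_simp
    have hlow : (x - ε) * M ≤
        (∑ e : E n, pinnedSum (activity w x / √(n : ℝ)) w (T n) {e}) / Z / scale n := by
      rw [le_div_iff₀ hv, le_div_iff₀ (by linarith)]
      refine le_trans (le_of_eq ?_) (Finset.card_nsmul_le_sum _ _ _ fun e _ => (h1 e).1)
      rw [Finset.card_univ, (hT n).card_elements, nsmul_eq_mul, hM]
      field_simp
    rw [Real.dist_eq, abs_lt]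
    have h2' := abs_lt.1 h2
    constructor <;> nlinarith
  have := hocc.mul_const ((1 + 2 * (1 - w) * x ^ 2) / x)
  rw [show x / 2 * ((1 + 2 * (1 - w) * x ^ 2) / x) = 1 / 2 + (1 - w) * x ^ 2 by
    field_simp] at this
  refine this.congr fun n => ?_
  unfold activity
  field_simp

/-- The limiting free energy at activity `activity w b / √n`. -/
lemma tendsto_logPartFun (hT : ∀ n, IsTriangleSystem (T n) n) (hw : 0 ≤ w)
    (hw1 : w ≤ 1) {b : ℝ} (hb : 0 ≤ b) (hb1 : b ≤ 1 / 4) :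
    Tendsto (fun n : ℕ => Real.log (partFun (T n) w (activity w b / √(n : ℝ))) / scale n) atTop
      (𝓝 (b / 2 + (1 - w) * b ^ 3 / 3)) := by
  set g : ℕ → ℝ → ℝ := fun n x => partFunDeriv (T n) w (activity w x / √(n : ℝ)) *
        (Real.exp ((1 - w) * x ^ 2) * (1 + 2 * (1 - w) * x ^ 2) / √(n : ℝ)) /
        partFun (T n) w (activity w x / √(n : ℝ)) / scale n with hg
  have hZpos : ∀ n, ∀ x, 0 ≤ x → 0 < partFun (T n) w (activity w x / √(n : ℝ)) := fun n x hx =>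
    lt_of_lt_of_le one_pos (one_le_partFun (hT n)
      (div_nonneg (activity_nonneg hx) (Real.sqrt_nonneg _)) hw)
  have hder : ∀ n, ∀ x ∈ Set.uIcc 0 b, HasDerivAt
      (fun x => Real.log (partFun (T n) w (activity w x / √(n : ℝ))) / scale n) (g n x) x := by
    intro n x hx
    rw [Set.uIcc_of_le hb] at hx
    have h1 := (hasDerivAt_partFun (T n) w (activity w x / √(n : ℝ))).comp x
      ((hasDerivAt_activity w x).div_const √(n : ℝ))
    exact (h1.log (hZpos n x hx.1).ne').div_const (scale n)
  have hcont : ∀ n, ContinuousOn (g n) (Set.uIcc 0 b) := by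
    intro n
    rw [Set.uIcc_of_le hb]
    have ha : Continuous (activity w) := by unfold activity; fun_prop
    have h1 : Continuous fun x => partFunDeriv (T n) w (activity w x / √(n : ℝ)) := by
      unfold partFunDeriv; fun_prop
    have h2 : Continuous fun x => partFun (T n) w (activity w x / √(n : ℝ)) := by
      unfold partFun; fun_prop
    refine ContinuousOn.div_const (ContinuousOn.div (by fun_prop) h2.continuousOn ?_) _
    intro x hx
    exact (hZpos n x hx.1).ne'
  have hinter : ∀ n, ∫ x in (0 : ℝ)..b, g n x
      = Real.log (partFun (T n) w (activity w b / √(n : ℝ))) / scale n := by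
    intro n
    rw [intervalIntegral.integral_eq_sub_of_hasDerivAt (hder n) (hcont n).intervalIntegrable]
    have : partFun (T n) w (activity w 0 / √(n : ℝ)) = 1 := by
      unfold partFun
      rw [Finset.sum_eq_single ∅]
      · simp [(hT n).containedCount_empty]
      · intro U _ hU
        rw [activity, zero_mul, zero_div, zero_pow (Finset.card_ne_zero.2
          (Finset.nonempty_iff_ne_empty.2 hU)), zero_mul]
      · simp
    rw [this, Real.log_one, zero_div, sub_zero]
  have hlim : ∫ x in (0 : ℝ)..b, (1 / 2 + (1 - w) * x ^ 2) = b / 2 + (1 - w) * b ^ 3 / 3 := by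
    rw [intervalIntegral.integral_add (by simp) (by
      apply Continuous.intervalIntegrable; fun_prop), intervalIntegral.integral_const_mul,
      integral_pow]
    simp; ring
  rw [← hlim]
  simp_rw [← hinter]
  refine intervalIntegral.tendsto_integral_filter_of_dominated_convergence
    (fun x => Real.exp ((1 - w) * x ^ 2) * (1 + 2 * (1 - w) * x ^ 2)) ?_ ?_ ?_ ?_
  · refine Eventually.of_forall fun n => ?_
    rw [Set.uIoc_of_le hb]
    refine ContinuousOn.aestronglyMeasurable ?_ measurableSet_Ioc
    refine (hcont n).mono ?_
    rw [Set.uIcc_of_le hb]; exact Set.Ioc_subset_Icc_self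
  · filter_upwards [eventually_gt_atTop 0] with n hn
    refine MeasureTheory.ae_of_all _ fun x hx => ?_
    rw [Set.uIoc_of_le hb] at hx
    have hx0 : 0 < x := hx.1
    have hz : 0 ≤ 1 - w := by linarith
    have hs : 0 < √(n : ℝ) := by positivity
    have hv := scale_pos hn
    have hZ := hZpos n x hx0.le
    have hlam : 0 < activity w x / √(n : ℝ) := by unfold activity; positivity
    have h1 := mul_partFunDeriv_le (hT n) hlam.le hw hw1
    have h2 : partFunDeriv (T n) w (activity w x / √(n : ℝ)) ≤
        n.choose 2 * partFun (T n) w (activity w x / √(n : ℝ)) := by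
      rw [mul_left_comm] at h1
      exact le_of_mul_le_mul_left h1 hlam
    have h3 := partFunDeriv_nonneg (T n) hlam.le hw
    have hM1 : (n.choose 2 : ℝ) / √(n : ℝ) / scale n ≤ 1 := by
      rw [choose_two_div n hn]
      have : (0 : ℝ) ≤ 1 / n := by positivity
      linarith
    have ha : 0 ≤ Real.exp ((1 - w) * x ^ 2) * (1 + 2 * (1 - w) * x ^ 2) := by positivity
    simp only [hg]
    generalize Real.exp ((1 - w) * x ^ 2) * (1 + 2 * (1 - w) * x ^ 2) = a at ha
    generalize partFunDeriv (T n) w (activity w x / √(n : ℝ)) = Z' at h2 h3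
    generalize partFun (T n) w (activity w x / √(n : ℝ)) = Z at h2 hZ
    have ha' : 0 ≤ a / √(n : ℝ) := div_nonneg ha hs.le
    rw [Real.norm_of_nonneg (div_nonneg (div_nonneg (mul_nonneg h3 ha') hZ.le) hv.le)]
    calc Z' * (a / √(n : ℝ)) / Z / scale n
        ≤ n.choose 2 * Z * (a / √(n : ℝ)) / Z / scale n :=
          div_le_div_of_nonneg_right (div_le_div_of_nonneg_right
            (mul_le_mul_of_nonneg_right h2 ha') hZ.le) hv.le
      _ = (n.choose 2 : ℝ) / √(n : ℝ) / scale n * a := by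
        rw [mul_right_comm, mul_div_cancel_right₀ _ hZ.ne']; ring
      _ ≤ 1 * a := mul_le_mul_of_nonneg_right hM1 ha
      _ = a := one_mul a
  · apply Continuous.intervalIntegrable; fun_prop
  · refine MeasureTheory.ae_of_all _ fun x hx => ?_
    rw [Set.uIoc_of_le hb] at hx
    exact tendsto_logPartFun_deriv hT hw hw1 hx.1 (hx.2.trans hb1)

end PartitionFunction

section Concentration

open Topology

variable {I : ℕ → Type*} [∀ n, Fintype (I n)]

/-- Exponential Markov inequality for tilted sums. -/
lemma eventually_tilted_tail_le {a : ∀ n, I n → ℝ} {y : ∀ n, I n → ℕ} {v : ℕ → ℝ}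
    (ha : ∀ n i, 0 ≤ a n i) (hv : Tendsto v atTop atTop) {s₀ s₁ H₀ H₁ κ : ℝ}
    (hs₀ : 0 < s₀) (hs₁ : 0 < s₁)
    (h0pos : ∀ᶠ n in atTop, 0 < ∑ i, a n i * s₀ ^ y n i)
    (h1pos : ∀ᶠ n in atTop, 0 < ∑ i, a n i * s₁ ^ y n i)
    (h0 : Tendsto (fun n => Real.log (∑ i, a n i * s₀ ^ y n i) / v n) atTop (𝓝 H₀))
    (h1 : Tendsto (fun n => Real.log (∑ i, a n i * s₁ ^ y n i) / v n) atTop (𝓝 H₁))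
    (hgap : H₁ + κ * (Real.log s₀ - Real.log s₁) < H₀) (J : ∀ n, I n → Prop)
    (hJ : ∀ n i, J n i →
      y n i * (Real.log s₀ - Real.log s₁) ≤ κ * v n * (Real.log s₀ - Real.log s₁)) :
    ∀ᶠ n in atTop, ∑ i with J n i, a n i * s₀ ^ y n i ≤ 1 / 4 * ∑ i, a n i * s₀ ^ y n i := by
  set L := Real.log s₀ - Real.log s₁ with hL
  set g := (H₀ - (H₁ + κ * L)) / 3 with hg
  have hg0 : 0 < g := by rw [hg]; linarith
  have e0 : ∀ᶠ n in atTop, H₀ - g < Real.log (∑ i, a n i * s₀ ^ y n i) / v n :=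
    h0.eventually (lt_mem_nhds (by linarith))
  have e1 : ∀ᶠ n in atTop, Real.log (∑ i, a n i * s₁ ^ y n i) / v n < H₁ + g :=
    h1.eventually (gt_mem_nhds (by linarith))
  have e2 : ∀ᶠ n in atTop, Real.log 4 / g ≤ v n := hv.eventually (eventually_ge_atTop _)
  filter_upwards [h0pos, h1pos, e0, e1, e2, hv.eventually (eventually_gt_atTop 0)]
    with n p0 p1 e0 e1 e2 hvn
  rw [lt_div_iff₀ hvn] at e0
  rw [div_lt_iff₀ hvn] at e1
  rw [div_le_iff₀ hg0] at e2
  have hterm : ∀ i, J n i → a n i * s₀ ^ y n i ≤ Real.exp (κ * v n * L) * (a n i * s₁ ^ y n i) := by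
    intro i hi
    have h2 : s₀ ^ y n i = Real.exp (y n i * L) * s₁ ^ y n i := by
      rw [hL, mul_sub, Real.exp_sub, ← Real.log_pow, ← Real.log_pow, Real.exp_log (by positivity),
        Real.exp_log (by positivity)]
      field_simp
    rw [h2]
    have h3 := Real.exp_le_exp.2 (hJ n i hi)
    have h4 : 0 ≤ a n i * s₁ ^ y n i := mul_nonneg (ha n i) (by positivity)
    calc _ = Real.exp (y n i * L) * (a n i * s₁ ^ y n i) := by ring
      _ ≤ _ := mul_le_mul_of_nonneg_right h3 h4
  have h3 : ∑ i with J n i, a n i * s₀ ^ y n i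
      ≤ Real.exp (κ * v n * L) * ∑ i, a n i * s₁ ^ y n i := by
    rw [Finset.mul_sum]
    refine (Finset.sum_le_sum fun i hi => hterm i (Finset.mem_filter.1 hi).2).trans ?_
    refine Finset.sum_le_sum_of_subset_of_nonneg (Finset.filter_subset _ _) fun i _ _ => ?_
    have := ha n i
    positivity
  refine h3.trans ?_
  rw [← Real.exp_log p0, ← Real.exp_log p1, ← Real.exp_add]
  have h4 : (1 / 4 : ℝ) = Real.exp (-Real.log 4) := by
    rw [Real.exp_neg, Real.exp_log (by norm_num)]; norm_num
  rw [h4, ← Real.exp_add, Real.exp_le_exp]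
  have h5 : 3 * g = H₀ - (H₁ + κ * L) := by rw [hg]; ring
  have h6 : 3 * g * v n = (H₀ - (H₁ + κ * L)) * v n := by rw [h5]
  nlinarith

lemma exists_gt_lt_of_deriv_neg {G : ℝ → ℝ} {G' x : ℝ} (h : HasDerivAt G G' x) (hG : G' < 0)
    {p : ℝ → Prop} (hp : ∀ᶠ z in 𝓝 x, p z) : ∃ z, x < z ∧ p z ∧ G z < G x := by
  have h1 := (hasDerivAt_iff_tendsto_slope.1 h).eventually (gt_mem_nhds hG)
  have h2 : ∀ᶠ z in 𝓝[>] x, slope G x z < 0 :=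
    h1.filter_mono (nhdsWithin_mono _ fun z hz => ne_of_gt hz)
  obtain ⟨z, hz1, hz2, hz3⟩ := (h2.and ((hp.filter_mono nhdsWithin_le_nhds).and
    self_mem_nhdsWithin)).exists
  refine ⟨z, hz3, hz2, ?_⟩
  have hz3' : x < z := hz3
  rw [slope_def_field, div_neg_iff] at hz1
  rcases hz1 with h | h <;> linarith [h.1, h.2]

lemma exists_lt_lt_of_deriv_pos {G : ℝ → ℝ} {G' x : ℝ} (h : HasDerivAt G G' x) (hG : 0 < G')
    {p : ℝ → Prop} (hp : ∀ᶠ z in 𝓝 x, p z) : ∃ z, z < x ∧ p z ∧ G z < G x := by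
  have h1 := (hasDerivAt_iff_tendsto_slope.1 h).eventually (lt_mem_nhds hG)
  have h2 : ∀ᶠ z in 𝓝[<] x, 0 < slope G x z :=
    h1.filter_mono (nhdsWithin_mono _ fun z hz => ne_of_lt hz)
  obtain ⟨z, hz1, hz2, hz3⟩ := (h2.and ((hp.filter_mono nhdsWithin_le_nhds).and
    self_mem_nhdsWithin)).exists
  refine ⟨z, hz3, hz2, ?_⟩
  have hz3' : z < x := hz3
  rw [slope_def_field, div_pos_iff] at hz1
  rcases hz1 with h | h <;> linarith [h.1, h.2]

/-- A tilted family whose normalised log-partition function converges to a differentiable limit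
concentrates around the derivative of the limit. -/
lemma eventually_half_le_window {a : ∀ n, I n → ℝ} {y : ∀ n, I n → ℕ} {v : ℕ → ℝ}
    (ha : ∀ n i, 0 ≤ a n i) (hv : Tendsto v atTop atTop) {s H : ℝ → ℝ} {x s' h' q δ : ℝ}
    (hs : HasDerivAt s s' x) (hs' : 0 < s') (hsx : 0 < s x) (hH : HasDerivAt H h' x)
    (hq : h' * s x = q * s') (hδ : 0 < δ)
    (hpos : ∀ᶠ z in 𝓝 x, ∀ᶠ n in atTop, 0 < ∑ i, a n i * s z ^ y n i)
    (hlim : ∀ᶠ z in 𝓝 x,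
      Tendsto (fun n => Real.log (∑ i, a n i * s z ^ y n i) / v n) atTop (𝓝 (H z))) :
    ∀ᶠ n in atTop, 1 / 2 * ∑ i, a n i * s x ^ y n i ≤
      ∑ i with (q - δ) * v n ≤ y n i ∧ y n i ≤ (q + δ) * v n, a n i * s x ^ y n i := by
  have hlog : HasDerivAt (fun z => Real.log (s z)) (s' / s x) x := hs.log hsx.ne'
  have hspos : ∀ᶠ z in 𝓝 x, 0 < s z := hs.continuousAt.eventually (lt_mem_nhds hsx)
  have hq' : h' = q * (s' / s x) := by field_simp; linarith
  have hr : 0 < s' / s x := div_pos hs' hsx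
  have hslope : ∀ᶠ z in 𝓝 x, (x < z → s x < s z) ∧ (z < x → s z < s x) := by
    have h1 := (hasDerivAt_iff_tendsto_slope.1 hs).eventually (lt_mem_nhds hs')
    rw [eventually_nhdsWithin_iff] at h1
    filter_upwards [h1] with z hz
    constructor
    · intro hxz
      have := hz (ne_of_gt hxz)
      rw [slope_def_field, div_pos_iff] at this
      rcases this with h | h <;> linarith [h.1, h.2]
    · intro hxz
      have := hz (ne_of_lt hxz)
      rw [slope_def_field, div_pos_iff] at this
      rcases this with h | h <;> linarith [h.1, h.2]
  have hall := hspos.and (hslope.and (hpos.and hlim))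
  have hx := hall.self_of_nhds
  obtain ⟨z, hzx, ⟨hz1, hz2, hz3, hz4⟩, hzG⟩ := exists_gt_lt_of_deriv_neg
    (hH.sub (hlog.const_mul (q + δ))) (by rw [hq']; nlinarith) hall
  obtain ⟨u, hux, ⟨hu1, hu2, hu3, hu4⟩, huG⟩ := exists_lt_lt_of_deriv_pos
    (hH.sub (hlog.const_mul (q - δ))) (by rw [hq']; nlinarith) hall
  have hzl : Real.log (s x) < Real.log (s z) := Real.log_lt_log hsx (hz2.1 hzx)
  have hul : Real.log (s u) < Real.log (s x) := Real.log_lt_log hu1 (hu2.2 hux)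
  simp only [Pi.sub_apply] at hzG huG
  have tu := eventually_tilted_tail_le (κ := q + δ) ha hv hsx hz1 hx.2.2.1 hz3 hx.2.2.2 hz4
    (by linarith) (fun n i => (q + δ) * v n < y n i) fun n i hi => by nlinarith
  have tl := eventually_tilted_tail_le (κ := q - δ) ha hv hsx hu1 hx.2.2.1 hu3 hx.2.2.2 hu4
    (by linarith) (fun n i => (y n i : ℝ) < (q - δ) * v n) fun n i hi => by nlinarith
  filter_upwards [tu, tl] with n h1 h2
  have hnn : ∀ i, 0 ≤ a n i * s x ^ y n i := fun i => mul_nonneg (ha n i) (by positivity)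
  have hsum : ∑ i, a n i * s x ^ y n i ≤
      ∑ i with (q - δ) * v n ≤ y n i ∧ y n i ≤ (q + δ) * v n, a n i * s x ^ y n i +
      (∑ i with (q + δ) * v n < y n i, a n i * s x ^ y n i +
        ∑ i with (y n i : ℝ) < (q - δ) * v n, a n i * s x ^ y n i) := by
    rw [Finset.sum_filter, Finset.sum_filter, Finset.sum_filter, ← Finset.sum_add_distrib,
      ← Finset.sum_add_distrib]
    refine Finset.sum_le_sum fun i _ => ?_
    have := hnn i
    by_cases c1 : (q + δ) * v n < y n i
    · rw [if_pos c1]; split_ifs <;> linarith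
    · by_cases c2 : (y n i : ℝ) < (q - δ) * v n
      · rw [if_pos c2]; split_ifs <;> linarith
      · rw [if_pos ⟨not_lt.1 c2, not_lt.1 c1⟩, if_neg c1, if_neg c2]; linarith
  linarith

end Concentration

section Levels

open Topology

variable {E : Type*} [Fintype E]

/-- The sum of `w^{#{t ∈ T : t ⊆ U}}` over the sets `U` of size `m`. -/
def levelSum (T : Finset (Finset E)) (w : ℝ) (m : ℕ) : ℝ :=
  ∑ U ∈ Finset.powersetCard m Finset.univ, w ^ containedCount T U

/-- The mean of `w^{#{t ∈ T : t ⊆ U}}` over the sets `U` of size `m`. -/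
def levelMean (T : Finset (Finset E)) (w : ℝ) (m : ℕ) : ℝ :=
  levelSum T w m / ((Fintype.card E).choose m : ℝ)

lemma levelSum_nonneg (T : Finset (Finset E)) {w : ℝ} (hw : 0 ≤ w) (m : ℕ) :
    0 ≤ levelSum T w m :=
  Finset.sum_nonneg fun _ _ => by positivity

lemma levelMean_nonneg (T : Finset (Finset E)) {w : ℝ} (hw : 0 ≤ w) (m : ℕ) :
    0 ≤ levelMean T w m :=
  div_nonneg (levelSum_nonneg T hw m) (Nat.cast_nonneg _)

lemma levelSum_one (T : Finset (Finset E)) (m : ℕ) :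
    levelSum T 1 m = ((Fintype.card E).choose m : ℝ) := by
  simp [levelSum, Finset.card_powersetCard]

lemma levelSum_eq (T : Finset (Finset E)) (w : ℝ) (m : ℕ) :
    levelSum T w m = ((Fintype.card E).choose m : ℝ) * levelMean T w m := by
  rcases le_or_gt m (Fintype.card E) with h | h
  · have : ((Fintype.card E).choose m : ℝ) ≠ 0 := by exact_mod_cast (Nat.choose_pos h).ne'
    rw [levelMean]; field_simp
  · rw [levelSum, Finset.powersetCard_eq_empty.2 (by simpa using h), Nat.choose_eq_zero_of_lt h]
    simp

lemma succ_mul_levelSum_succ_le (T : Finset (Finset E)) {w : ℝ} (hw : 0 ≤ w) (hw1 : w ≤ 1)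
    (m : ℕ) :
    (m + 1) * levelSum T w (m + 1) ≤ ((Fintype.card E - m : ℕ) : ℝ) * levelSum T w m := by
  have h1 : ∑ U ∈ Finset.powersetCard (m + 1) (Finset.univ : Finset E),
      ∑ _e ∈ U, w ^ containedCount T U = (m + 1) * levelSum T w (m + 1) := by
    rw [levelSum, Finset.mul_sum]
    refine Finset.sum_congr rfl fun U hU => ?_
    rw [Finset.sum_const, (Finset.mem_powersetCard.1 hU).2, nsmul_eq_mul]
    push_cast; ring
  have h2 : ∑ U ∈ Finset.powersetCard m (Finset.univ : Finset E),
      ∑ _e ∈ Uᶜ, w ^ containedCount T U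
        = ((Fintype.card E - m : ℕ) : ℝ) * levelSum T w m := by
    rw [levelSum, Finset.mul_sum]
    refine Finset.sum_congr rfl fun U hU => ?_
    rw [Finset.sum_const, Finset.card_compl, (Finset.mem_powersetCard.1 hU).2, nsmul_eq_mul]
  rw [← h1, ← h2, Finset.sum_sigma', Finset.sum_sigma']
  calc _ ≤ ∑ p ∈ (Finset.powersetCard (m + 1) (Finset.univ : Finset E)).sigma fun U => U,
        w ^ containedCount T (p.1.erase p.2) := by
        refine Finset.sum_le_sum fun p _ => pow_le_pow_of_le_one hw hw1 ?_
        exact containedCount_mono_right T (Finset.erase_subset _ _)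
    _ = _ := by
        refine Finset.sum_bij' (fun p _ => ⟨p.1.erase p.2, p.2⟩) (fun p _ => ⟨insert p.2 p.1, p.2⟩)
          ?_ ?_ ?_ ?_ ?_
        · rintro ⟨U, e⟩ hp
          simp only [Finset.mem_sigma, Finset.mem_powersetCard, Finset.subset_univ, true_and,
            Finset.mem_compl, Finset.notMem_erase, not_false_eq_true, and_true] at hp ⊢
          rw [Finset.card_erase_of_mem hp.2, hp.1]; simp
        · rintro ⟨U, e⟩ hp
          simp only [Finset.mem_sigma, Finset.mem_powersetCard, Finset.subset_univ, true_and,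
            Finset.mem_compl, Finset.mem_insert_self, and_true] at hp ⊢
          rw [Finset.card_insert_of_notMem hp.2, hp.1]
        · rintro ⟨U, e⟩ hp
          simp only [Finset.mem_sigma] at hp
          simp [Finset.insert_erase hp.2]
        · rintro ⟨U, e⟩ hp
          simp only [Finset.mem_sigma, Finset.mem_compl] at hp
          simp [Finset.erase_insert hp.2]
        · rintro ⟨U, e⟩ _; rfl

lemma levelMean_antitone (T : Finset (Finset E)) {w : ℝ} (hw : 0 ≤ w) (hw1 : w ≤ 1) :
    Antitone (levelMean T w) := by
  refine antitone_nat_of_succ_le fun m => ?_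
  rcases Nat.lt_or_ge m (Fintype.card E) with h | h
  · have hc : (0 : ℝ) < ((Fintype.card E).choose m : ℝ) := by exact_mod_cast Nat.choose_pos h.le
    have hc1 : (0 : ℝ) < ((Fintype.card E).choose (m + 1) : ℝ) := by
      exact_mod_cast Nat.choose_pos h
    have hmul : ((Fintype.card E).choose (m + 1) : ℝ) * (m + 1)
        = (Fintype.card E).choose m * ((Fintype.card E - m : ℕ) : ℝ) := by
      exact_mod_cast Nat.choose_succ_right_eq (Fintype.card E) m
    have hs := succ_mul_levelSum_succ_le T hw hw1 m
    unfold levelMean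
    rw [div_le_div_iff₀ hc1 hc]
    have hm : (0 : ℝ) < m + 1 := by positivity
    refine le_of_mul_le_mul_left ?_ hm
    have h3 := mul_le_mul_of_nonneg_left hs hc.le
    linear_combination h3 - levelSum T w m * hmul
  · have : levelMean T w (m + 1) = 0 := by
      rw [levelMean, Nat.choose_eq_zero_of_lt (by omega)]; simp
    rw [this]; exact levelMean_nonneg T hw m

lemma sum_card_mul_eq (T : Finset (Finset E)) (w : ℝ) (g : ℕ → ℝ) :
    ∑ U : Finset E, g U.card * w ^ containedCount T U =
      ∑ j ∈ Finset.range (Fintype.card E + 1), g j * levelSum T w j := by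
  rw [← Finset.powerset_univ, Finset.sum_powerset]
  refine Finset.sum_congr (by simp) fun j _ => ?_
  rw [levelSum, Finset.mul_sum]
  exact Finset.sum_congr rfl fun U hU => by rw [(Finset.mem_powersetCard.1 hU).2]

lemma sum_card_eq (T : Finset (Finset E)) (g : ℕ → ℝ) :
    ∑ U : Finset E, g U.card =
      ∑ j ∈ Finset.range (Fintype.card E + 1), g j * ((Fintype.card E).choose j : ℝ) := by
  simpa [levelSum_one] using sum_card_mul_eq T 1 g

lemma sum_card_mul_le (T : Finset (Finset E)) {w : ℝ} (hw : 0 ≤ w) (hw1 : w ≤ 1) {g : ℕ → ℝ}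
    (hg : ∀ j, 0 ≤ g j) {m : ℕ} (hm : ∀ j, j < m → g j = 0) :
    ∑ U : Finset E, g U.card * w ^ containedCount T U ≤
      levelMean T w m * ∑ U : Finset E, g U.card := by
  rw [sum_card_mul_eq, sum_card_eq T, Finset.mul_sum]
  refine Finset.sum_le_sum fun j _ => ?_
  rcases lt_or_ge j m with h | h
  · simp [hm j h]
  · have h1 := levelMean_antitone T hw hw1 h
    have h2 : 0 ≤ g j * ((Fintype.card E).choose j : ℝ) := mul_nonneg (hg j) (Nat.cast_nonneg _)
    rw [levelSum_eq]
    nlinarith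

lemma le_sum_card_mul (T : Finset (Finset E)) {w : ℝ} (hw : 0 ≤ w) (hw1 : w ≤ 1) {g : ℕ → ℝ}
    (hg : ∀ j, 0 ≤ g j) {m : ℕ} (hm : ∀ j, m < j → g j = 0) :
    levelMean T w m * ∑ U : Finset E, g U.card ≤
      ∑ U : Finset E, g U.card * w ^ containedCount T U := by
  rw [sum_card_mul_eq, sum_card_eq T, Finset.mul_sum]
  refine Finset.sum_le_sum fun j _ => ?_
  rcases lt_or_ge m j with h | h
  · simp [hm j h]
  · have h1 := levelMean_antitone T hw hw1 h
    have h2 : 0 ≤ g j * ((Fintype.card E).choose j : ℝ) := mul_nonneg (hg j) (Nat.cast_nonneg _)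
    rw [levelSum_eq]
    nlinarith

lemma half_partFun_le (T : Finset (Finset E)) {w lam μ t C : ℝ} (hw : 0 ≤ w) (hw1 : w ≤ 1)
    (hμ : 0 ≤ μ) (ht : 0 ≤ t) (hlam : lam = μ * Real.exp t) {lo hi : ℝ} {m : ℕ} (hm : m ≤ lo)
    (hC : C ≤ ∑ U : Finset E with lo ≤ U.card ∧ U.card ≤ hi,
      lam ^ U.card * w ^ containedCount T U) :
    C ≤ levelMean T w m * (Real.exp (t * hi) * partFun T 1 μ) := by
  have hl : 0 ≤ lam := by rw [hlam]; positivity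
  let g : ℕ → ℝ := fun j => if lo ≤ j ∧ j ≤ hi then lam ^ j else 0
  have hg : ∀ j, 0 ≤ g j := fun j => by dsimp only [g]; split_ifs <;> positivity
  have h1 := sum_card_mul_le T hw hw1 hg (m := m) fun j hj => if_neg fun h => by
    have : (j : ℝ) < m := by exact_mod_cast hj
    linarith [h.1]
  have h2 : C ≤ ∑ U : Finset E, g U.card * w ^ containedCount T U := by
    refine hC.trans_eq ?_
    rw [Finset.sum_filter]
    refine Finset.sum_congr rfl fun U _ => ?_
    simp only [g]; split_ifs <;> simp
  refine (h2.trans h1).trans (mul_le_mul_of_nonneg_left ?_ (levelMean_nonneg T hw m))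
  simp only [partFun, one_pow, mul_one]
  rw [Finset.mul_sum]
  refine Finset.sum_le_sum fun U _ => ?_
  simp only [g]
  split_ifs with h
  · rw [hlam, mul_pow, mul_comm, ← Real.exp_nat_mul]
    refine mul_le_mul_of_nonneg_right (Real.exp_le_exp.2 ?_) (by positivity)
    nlinarith [h.2]
  · positivity

lemma levelMean_mul_le_partFun (T : Finset (Finset E)) {w lam μ t C : ℝ} (hw : 0 ≤ w) (hw1 : w ≤ 1)
    (hμ : 0 ≤ μ) (ht : 0 ≤ t) (hlam : lam = μ * Real.exp t) {lo hi : ℝ} {m : ℕ} (hm : hi ≤ m)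
    (hC : C ≤ ∑ U : Finset E with lo ≤ U.card ∧ U.card ≤ hi,
      μ ^ U.card * (1 : ℝ) ^ containedCount T U) :
    levelMean T w m * (Real.exp (t * lo) * C) ≤ partFun T w lam := by
  have hl : 0 ≤ lam := by rw [hlam]; positivity
  let g : ℕ → ℝ := fun j => if lo ≤ j ∧ j ≤ hi then lam ^ j else 0
  have hg : ∀ j, 0 ≤ g j := fun j => by dsimp only [g]; split_ifs <;> positivity
  have h1 := le_sum_card_mul T hw hw1 hg (m := m) fun j hj => if_neg fun h => by
    have : (m : ℝ) < j := by exact_mod_cast hj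
    linarith [h.2]
  have h2 : ∑ U : Finset E, g U.card * w ^ containedCount T U ≤ partFun T w lam := by
    refine Finset.sum_le_sum fun U _ => mul_le_mul_of_nonneg_right ?_ (by positivity)
    simp only [g]; split_ifs
    · exact le_rfl
    · positivity
  refine le_trans (mul_le_mul_of_nonneg_left ?_ (levelMean_nonneg T hw m)) (h1.trans h2)
  refine (mul_le_mul_of_nonneg_left hC (Real.exp_nonneg _)).trans ?_
  rw [Finset.mul_sum, Finset.sum_filter]
  refine Finset.sum_le_sum fun U _ => ?_
  simp only [g, one_pow, mul_one]
  split_ifs with h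
  · rw [hlam, mul_pow, mul_comm (μ ^ _), ← Real.exp_nat_mul]
    refine mul_le_mul_of_nonneg_right (Real.exp_le_exp.2 ?_) (by positivity)
    nlinarith [h.1]
  · exact le_rfl

end Levels

section LevelAsymptotics

open Topology

variable {E : ℕ → Type*} [∀ n, Fintype (E n)] {T : ∀ n, Finset (Finset (E n))} {w b x δ : ℝ}

lemma eventually_half_partFun_le_window (hT : ∀ n, IsTriangleSystem (T n) n) (hw : 0 ≤ w)
    (hw1 : w ≤ 1) (hx : 0 < x) (hx1 : x < 1 / 4) (hδ : 0 < δ) :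
    ∀ᶠ n : ℕ in atTop, 1 / 2 * partFun (T n) w (activity w x / √n) ≤
      ∑ U : Finset (E n) with (x / 2 - δ) * scale n ≤ U.card ∧ U.card ≤ (x / 2 + δ) * scale n,
        (activity w x / √n) ^ U.card * w ^ containedCount (T n) U := by
  have hterm : ∀ (z : ℝ) (n : ℕ) (U : Finset (E n)),
      w ^ containedCount (T n) U * (1 / √(n : ℝ)) ^ U.card * activity w z ^ U.card =
        (activity w z / √n) ^ U.card * w ^ containedCount (T n) U := by
    intro z n U
    rw [div_eq_mul_one_div (activity w z), mul_pow]; ring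
  have hIoo : ∀ᶠ z in 𝓝 x, z ∈ Set.Ioo (0 : ℝ) (1 / 4) := Ioo_mem_nhds hx hx1
  have key := eventually_half_le_window (I := fun n => Finset (E n))
    (a := fun n U => w ^ containedCount (T n) U * (1 / √(n : ℝ)) ^ U.card)
    (y := fun n U => U.card) (v := scale) (s := activity w)
    (H := fun z => z / 2 + (1 - w) * z ^ 3 / 3) (x := x) (q := x / 2) (δ := δ)
    (h' := 1 / 2 + (1 - w) * x ^ 2)
    (fun n U => by positivity) tendsto_scale (hasDerivAt_activity w x)
    (by have : 0 ≤ (1 - w) * x ^ 2 := by nlinarith [sq_nonneg x]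
        have := Real.exp_pos ((1 - w) * x ^ 2)
        exact mul_pos this (by linarith))
    (by unfold activity; positivity)
    (by
      have h1 := (hasDerivAt_id x).div_const 2
      have h2 := (((hasDerivAt_id x).pow 3).const_mul (1 - w)).div_const 3
      refine (h1.add h2).congr_deriv ?_
      simp only [id, Nat.cast_ofNat]; ring)
    (by unfold activity; ring) hδ
    (by
      filter_upwards [hIoo] with z hz
      filter_upwards with n
      simp only [hterm]
      exact zero_lt_one.trans_le (one_le_partFun (hT n)
        (div_nonneg (activity_nonneg hz.1.le) (Real.sqrt_nonneg _)) hw))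
    (by
      filter_upwards [hIoo] with z hz
      simp only [hterm]
      exact tendsto_logPartFun hT hw hw1 hz.1.le hz.2.le)
  simpa only [hterm, partFun] using key

lemma activity_div (w x : ℝ) (n : ℕ) :
    activity w x / √n = activity 1 x / √n * Real.exp ((1 - w) * x ^ 2) := by
  unfold activity; simp; ring

lemma eventually_levelMean_lower (hT : ∀ n, IsTriangleSystem (T n) n) (hw : 0 ≤ w) (hw1 : w ≤ 1)
    (hb : 0 < b) (hx : b < x) (hx1 : x < 1 / 4) {m : ℕ → ℕ}
    (hm : Tendsto (fun n => (m n : ℝ) / scale n) atTop (𝓝 (b / 2))) {l : ℝ}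
    (hl : l < -((1 - w) * x ^ 3 / 6) - (1 - w) * x ^ 2 * ((x - b) / 4)) :
    ∀ᶠ n : ℕ in atTop, 0 < levelMean (T n) w (m n) ∧
      l < Real.log (levelMean (T n) w (m n)) / scale n := by
  have hx0 : 0 < x := hb.trans hx
  have hwin := eventually_half_partFun_le_window hT hw hw1 hx0 hx1 (δ := (x - b) / 4)
    (by linarith)
  have hmlo : ∀ᶠ n in atTop, (m n : ℝ) / scale n < x / 2 - (x - b) / 4 :=
    hm.eventually (gt_mem_nhds (by linarith))
  have h1 := tendsto_logPartFun hT hw hw1 hx0.le hx1.le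
  have h2 := tendsto_logPartFun hT zero_le_one le_rfl hx0.le hx1.le
  have hc : Tendsto (fun n => Real.log (1 / 2) / scale n) atTop (𝓝 0) :=
    tendsto_const_nhds.div_atTop tendsto_scale
  have hlim := ((h1.sub h2).add hc).sub_const ((1 - w) * x ^ 2 * (x / 2 + (x - b) / 4))
  have hev := hlim.eventually (lt_mem_nhds (show l < _ by
    refine hl.trans_le (le_of_eq ?_); ring))
  filter_upwards [hwin, hmlo, hev, eventually_gt_atTop 0] with n hn1 hn2 hn3 hn
  have hv := scale_pos hn
  have hμ : 0 ≤ activity 1 x / √(n : ℝ) :=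
    div_nonneg (activity_nonneg hx0.le) (Real.sqrt_nonneg _)
  have hZ := one_le_partFun (hT n) (w := w)
    (div_nonneg (activity_nonneg hx0.le) (Real.sqrt_nonneg _) : 0 ≤ activity w x / √(n : ℝ)) hw
  have hZ1 := one_le_partFun (hT n) hμ zero_le_one
  have hle := half_partFun_le (T n) hw hw1 hμ (t := (1 - w) * x ^ 2)
    (by nlinarith [sq_nonneg x]) (activity_div w x n) ((div_lt_iff₀ hv).1 hn2).le hn1
  have hpos : 0 < levelMean (T n) w (m n) := by
    rcases (levelMean_nonneg (T n) hw (m n)).lt_or_eq with h | h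
    · exact h
    · rw [← h, zero_mul] at hle; linarith
  refine ⟨hpos, hn3.trans_le ?_⟩
  have hlog := Real.log_le_log (by linarith) hle
  rw [Real.log_mul (by norm_num) (by linarith), Real.log_mul hpos.ne' (by positivity),
    Real.log_mul (Real.exp_pos _).ne' (by linarith), Real.log_exp] at hlog
  rw [le_div_iff₀ hv]
  field_simp
  linarith

lemma eventually_levelMean_upper (hT : ∀ n, IsTriangleSystem (T n) n) (hw : 0 ≤ w) (hw1 : w ≤ 1)
    (hx0 : 0 < x) (hx : x < b) (hb1 : b < 1 / 4) {m : ℕ → ℕ}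
    (hm : Tendsto (fun n => (m n : ℝ) / scale n) atTop (𝓝 (b / 2))) {l : ℝ}
    (hl : -((1 - w) * x ^ 3 / 6) + (1 - w) * x ^ 2 * ((b - x) / 4) < l) :
    ∀ᶠ n : ℕ in atTop, 0 < levelMean (T n) w (m n) →
      Real.log (levelMean (T n) w (m n)) / scale n < l := by
  have hx1 : x < 1 / 4 := hx.trans hb1
  have hwin := eventually_half_partFun_le_window hT zero_le_one le_rfl hx0 hx1 (δ := (b - x) / 4)
    (by linarith)
  have hmlo : ∀ᶠ n in atTop, x / 2 + (b - x) / 4 < (m n : ℝ) / scale n :=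
    hm.eventually (lt_mem_nhds (by linarith))
  have h1 := tendsto_logPartFun hT hw hw1 hx0.le hx1.le
  have h2 := tendsto_logPartFun hT zero_le_one le_rfl hx0.le hx1.le
  have hc : Tendsto (fun n => Real.log (1 / 2) / scale n) atTop (𝓝 0) :=
    tendsto_const_nhds.div_atTop tendsto_scale
  have hlim := ((h1.sub h2).sub hc).sub_const ((1 - w) * x ^ 2 * (x / 2 - (b - x) / 4))
  have hev := hlim.eventually (gt_mem_nhds (show _ < l by
    refine (le_of_eq ?_).trans_lt hl; ring))
  filter_upwards [hwin, hmlo, hev, eventually_gt_atTop 0] with n hn1 hn2 hn3 hn hpos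
  have hv := scale_pos hn
  have hμ : 0 ≤ activity 1 x / √(n : ℝ) :=
    div_nonneg (activity_nonneg hx0.le) (Real.sqrt_nonneg _)
  have hZ := one_le_partFun (hT n) (w := w)
    (div_nonneg (activity_nonneg hx0.le) (Real.sqrt_nonneg _) : 0 ≤ activity w x / √(n : ℝ)) hw
  have hZ1 := one_le_partFun (hT n) hμ zero_le_one
  have hle := levelMean_mul_le_partFun (T n) hw hw1 hμ (t := (1 - w) * x ^ 2)
    (by nlinarith [sq_nonneg x]) (activity_div w x n) ((lt_div_iff₀ hv).1 hn2).le hn1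
  refine lt_of_le_of_lt ?_ hn3
  have hlog := Real.log_le_log (by positivity) hle
  rw [Real.log_mul hpos.ne' (by positivity),
    Real.log_mul (Real.exp_pos _).ne' (by positivity), Real.log_exp,
    Real.log_mul (by norm_num) (by linarith)] at hlog
  rw [div_le_iff₀ hv]
  field_simp
  linarith

/-- The logarithmic moment generating function of the number of contained triples of a uniformly
random set of `m` elements. -/
lemma tendsto_log_levelMean (hT : ∀ n, IsTriangleSystem (T n) n) (hw : 0 ≤ w) (hw1 : w ≤ 1)
    (hb : 0 < b) (hb1 : b < 1 / 4) {m : ℕ → ℕ}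
    (hm : Tendsto (fun n => (m n : ℝ) / scale n) atTop (𝓝 (b / 2))) :
    (∀ᶠ n : ℕ in atTop, 0 < levelMean (T n) w (m n)) ∧
    Tendsto (fun n => Real.log (levelMean (T n) w (m n)) / scale n) atTop
      (𝓝 (-((1 - w) * b ^ 3 / 6))) := by
  have hlow : ∀ l < -((1 - w) * b ^ 3 / 6), ∀ᶠ n : ℕ in atTop,
      0 < levelMean (T n) w (m n) ∧ l < Real.log (levelMean (T n) w (m n)) / scale n := by
    intro l hl
    have hF : ContinuousAt
        (fun x : ℝ => -((1 - w) * x ^ 3 / 6) - (1 - w) * x ^ 2 * ((x - b) / 4)) b := by fun_prop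
    have h1 : ∀ᶠ x in 𝓝[>] b,
        l < -((1 - w) * x ^ 3 / 6) - (1 - w) * x ^ 2 * ((x - b) / 4) :=
      (hF.eventually (lt_mem_nhds (by simpa using hl))).filter_mono nhdsWithin_le_nhds
    obtain ⟨x, hx, hxb⟩ := (h1.and (Ioo_mem_nhdsGT hb1)).exists
    exact eventually_levelMean_lower hT hw hw1 hb hxb.1 hxb.2 hm hx
  have hpos := (hlow _ (sub_one_lt _)).mono fun n h => h.1
  refine ⟨hpos, tendsto_order.2 ⟨fun l hl => (hlow l hl).mono fun n h => h.2, fun l hl => ?_⟩⟩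
  have hF : ContinuousAt
      (fun x : ℝ => -((1 - w) * x ^ 3 / 6) + (1 - w) * x ^ 2 * ((b - x) / 4)) b := by fun_prop
  have h1 : ∀ᶠ x in 𝓝[<] b,
      -((1 - w) * x ^ 3 / 6) + (1 - w) * x ^ 2 * ((b - x) / 4) < l :=
    (hF.eventually (gt_mem_nhds (by simpa using hl))).filter_mono nhdsWithin_le_nhds
  obtain ⟨x, hx, hxb⟩ := (h1.and (Ioo_mem_nhdsLT hb)).exists
  filter_upwards [hpos, eventually_levelMean_upper hT hw hw1 hxb.1 hxb.2 hb1 hm hx] with n h2 h3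
  exact h3 h2

end LevelAsymptotics

section LowerTail

open Topology

/-- The probability that a uniformly random set of `m` elements contains at most `k` triples. -/
def lowerProb {E : Type*} [Fintype E] (T : Finset (Finset E)) (m : ℕ) (k : ℝ) : ℝ :=
  (((Finset.powersetCard m Finset.univ).filter fun U => (containedCount T U : ℝ) ≤ k).card : ℝ) /
    ((Fintype.card E).choose m : ℝ)

lemma lowerProb_nonneg {E : Type*} [Fintype E] (T : Finset (Finset E)) (m : ℕ) (k : ℝ) :
    0 ≤ lowerProb T m k := by
  unfold lowerProb; positivity

lemma lowerProb_zero {E : Type*} [Fintype E] (T : Finset (Finset E)) (m : ℕ) :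
    lowerProb T m 0 = levelMean T 0 m := by
  unfold lowerProb levelMean levelSum
  congr 1
  rw [Finset.card_filter]
  push_cast
  refine Finset.sum_congr rfl fun U _ => ?_
  rcases Nat.eq_zero_or_pos (containedCount T U) with h | h
  · simp [h]
  · have : ¬ ((containedCount T U : ℝ) ≤ 0) := by
      rw [not_le]; exact_mod_cast h
    rw [if_neg this, zero_pow h.ne']

lemma lowerProb_mul_rpow_le {E : Type*} [Fintype E] (T : Finset (Finset E)) {w : ℝ} (hw : 0 < w)
    (hw1 : w ≤ 1) (m : ℕ) (k : ℝ) :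
    lowerProb T m k * w ^ k ≤ levelMean T w m := by
  unfold lowerProb levelMean levelSum
  rw [div_mul_eq_mul_div]
  refine div_le_div_of_nonneg_right ?_ (Nat.cast_nonneg _)
  rw [← nsmul_eq_mul, ← Finset.sum_const, Finset.sum_filter]
  refine Finset.sum_le_sum fun U _ => ?_
  split_ifs with h
  · rw [← Real.rpow_natCast]
    exact Real.rpow_le_rpow_of_exponent_ge hw hw1 h
  · positivity

lemma levelMean_eq_sum {E : Type*} [Fintype E] (T : Finset (Finset E)) (w : ℝ) (m : ℕ) :
    levelMean T w m = ∑ U : Finset E,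
      (if U.card = m then 1 / ((Fintype.card E).choose m : ℝ) else 0) * w ^ containedCount T U := by
  unfold levelMean levelSum
  simp_rw [ite_mul, zero_mul]
  rw [← Finset.sum_filter, ← Finset.mul_sum, one_div_mul_eq_div]
  congr 2
  ext U; simp [Finset.mem_powersetCard]

lemma sum_window_le_lowerProb {E : Type*} [Fintype E] (T : Finset (Finset E)) {w : ℝ} (hw : 0 < w)
    (hw1 : w ≤ 1) (m : ℕ) {k lo hi : ℝ} (hk : hi ≤ k) :
    ∑ U : Finset E with lo ≤ containedCount T U ∧ containedCount T U ≤ hi,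
      (if U.card = m then 1 / ((Fintype.card E).choose m : ℝ) else 0) * w ^ containedCount T U ≤
    w ^ lo * lowerProb T m k := by
  have h : lowerProb T m k = ∑ U : Finset E,
      if U.card = m ∧ (containedCount T U : ℝ) ≤ k then 1 / ((Fintype.card E).choose m : ℝ)
        else 0 := by
    rw [← Finset.sum_filter, Finset.sum_const, nsmul_eq_mul, lowerProb, mul_one_div]
    congr 2
    congr 1
    ext U; simp [Finset.mem_powersetCard]
  rw [h, Finset.mul_sum, Finset.sum_filter]
  refine Finset.sum_le_sum fun U _ => ?_
  have hp : 0 < w ^ lo := Real.rpow_pos_of_pos hw _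
  by_cases h1 : U.card = m
  · by_cases h2 : lo ≤ containedCount T U ∧ containedCount T U ≤ hi
    · rw [if_pos h2, if_pos h1, if_pos ⟨h1, h2.2.trans hk⟩, mul_comm, ← Real.rpow_natCast]
      exact mul_le_mul_of_nonneg_right (Real.rpow_le_rpow_of_exponent_ge hw hw1 h2.1)
        (by positivity)
    · rw [if_neg h2]
      split_ifs <;> positivity
  · simp [h1]

variable {E : ℕ → Type*} [∀ n, Fintype (E n)] {T : ∀ n, Finset (Finset (E n))} {w b η : ℝ}

lemma eventually_lowerProb_lower (hT : ∀ n, IsTriangleSystem (T n) n) (hw : 0 < w) (hwη : w < η)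
    (hη : η < 1) (hb : 0 < b) (hb1 : b < 1 / 4) {m : ℕ → ℕ} {k : ℕ → ℝ}
    (hm : Tendsto (fun n => (m n : ℝ) / scale n) atTop (𝓝 (b / 2)))
    (hk : Tendsto (fun n => k n / scale n) atTop (𝓝 (η * (b ^ 3 / 6)))) {l : ℝ}
    (hl : l < -((1 - w) * b ^ 3 / 6)
      - (w * (b ^ 3 / 6) - (η - w) * (b ^ 3 / 6) / 2) * Real.log w) :
    ∀ᶠ n : ℕ in atTop, 0 < lowerProb (T n) (m n) (k n) ∧
      l < Real.log (lowerProb (T n) (m n) (k n)) / scale n := by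
  have hw1 : w < 1 := hwη.trans hη
  have hb3 : 0 < b ^ 3 / 6 := by positivity
  set q := w * (b ^ 3 / 6) with hq
  set δ := (η - w) * (b ^ 3 / 6) / 2 with hδ
  have hδ0 : 0 < δ := by rw [hδ]; have := mul_pos (sub_pos.2 hwη) hb3; linarith
  have hB := fun z (hz : z ∈ Set.Ioo (0 : ℝ) 1) =>
    tendsto_log_levelMean hT hz.1.le hz.2.le hb hb1 hm
  have hIoo : ∀ᶠ z in 𝓝 w, z ∈ Set.Ioo (0 : ℝ) 1 := Ioo_mem_nhds hw hw1
  have key := eventually_half_le_window (I := fun n => Finset (E n))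
    (a := fun n U => if U.card = m n then 1 / ((Fintype.card (E n)).choose (m n) : ℝ) else 0)
    (y := fun n U => containedCount (T n) U) (v := scale) (s := id)
    (H := fun z => -((1 - z) * b ^ 3 / 6)) (x := w) (q := q) (δ := δ)
    (h' := b ^ 3 / 6) (s' := 1)
    (fun n U => by split_ifs <;> positivity) tendsto_scale (hasDerivAt_id w) one_pos hw
    (by
      have h1 := ((((hasDerivAt_id w).const_sub 1).mul_const (b ^ 3)).div_const 6).neg
      refine h1.congr_deriv ?_
      ring)
    (by rw [hq]; simp; ring) hδ0
    (by
      filter_upwards [hIoo] with z hz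
      simpa only [id, ← levelMean_eq_sum] using (hB z hz).1)
    (by
      filter_upwards [hIoo] with z hz
      simpa only [id, ← levelMean_eq_sum] using (hB z hz).2)
  have hkev : ∀ᶠ n in atTop, q + δ < k n / scale n :=
    hk.eventually (lt_mem_nhds (by rw [hq, hδ]; nlinarith))
  have hc : Tendsto (fun n => Real.log (1 / 2) / scale n) atTop (𝓝 0) :=
    tendsto_const_nhds.div_atTop tendsto_scale
  have hlim := ((hB w ⟨hw, hw1⟩).2.add hc).sub_const ((q - δ) * Real.log w)
  have hev := hlim.eventually (lt_mem_nhds (show l < _ by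
    refine hl.trans_le (le_of_eq ?_); ring))
  filter_upwards [key, hkev, hev, (hB w ⟨hw, hw1⟩).1, eventually_gt_atTop 0]
    with n h1 h2 h3 h4 hn
  have hv := scale_pos hn
  simp only [id, ← levelMean_eq_sum] at h1
  have h5 := h1.trans (sum_window_le_lowerProb (T n) hw hw1.le (m n) ((lt_div_iff₀ hv).1 h2).le)
  have hp : 0 < w ^ ((q - δ) * scale n) := Real.rpow_pos_of_pos hw _
  have hpos : 0 < lowerProb (T n) (m n) (k n) := by
    rcases (lowerProb_nonneg (T n) (m n) (k n)).lt_or_eq with h | h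
    · exact h
    · rw [← h, mul_zero] at h5; linarith
  refine ⟨hpos, h3.trans_le ?_⟩
  have hlog := Real.log_le_log (by positivity) h5
  rw [Real.log_mul (by norm_num) h4.ne', Real.log_mul hp.ne' hpos.ne', Real.log_rpow hw] at hlog
  rw [le_div_iff₀ hv]
  field_simp
  linarith

lemma tendsto_log_lowerProb (hT : ∀ n, IsTriangleSystem (T n) n) (hη0 : 0 ≤ η)
    (hη : η < 1) (hb : 0 < b) (hb1 : b < 1 / 4) {m : ℕ → ℕ} {x : ℕ → ℝ}
    (hm : Tendsto (fun n => (m n : ℝ) / scale n) atTop (𝓝 (b / 2)))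
    (hx : Tendsto (fun n => x n / scale n) atTop (𝓝 (b ^ 3 / 6))) :
    Tendsto (fun n => Real.log (lowerProb (T n) (m n) (η * x n)) / scale n) atTop
      (𝓝 (-(b ^ 3 / 6) * (1 - η + η * Real.log η))) := by
  rcases hη0.eq_or_lt with rfl | hη0
  · have h := (tendsto_log_levelMean hT le_rfl zero_le_one hb hb1 hm).2
    simp only [zero_mul, lowerProb_zero]
    convert h using 2
    ring
  have hk : Tendsto (fun n => η * x n / scale n) atTop (𝓝 (η * (b ^ 3 / 6))) := by
    simpa only [mul_div_assoc] using hx.const_mul η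
  have hlow : ∀ l < -(b ^ 3 / 6) * (1 - η + η * Real.log η), ∀ᶠ n : ℕ in atTop,
      0 < lowerProb (T n) (m n) (η * x n) ∧
        l < Real.log (lowerProb (T n) (m n) (η * x n)) / scale n := by
    intro l hl
    have hF : ContinuousAt (fun w : ℝ => -((1 - w) * b ^ 3 / 6)
        - (w * (b ^ 3 / 6) - (η - w) * (b ^ 3 / 6) / 2) * Real.log w) η := by
      have := Real.continuousAt_log hη0.ne'
      fun_prop
    have h1 : ∀ᶠ w in 𝓝[<] η, l < -((1 - w) * b ^ 3 / 6)
        - (w * (b ^ 3 / 6) - (η - w) * (b ^ 3 / 6) / 2) * Real.log w := by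
      refine (hF.eventually (lt_mem_nhds ?_)).filter_mono nhdsWithin_le_nhds
      refine hl.trans_le (le_of_eq ?_)
      ring
    obtain ⟨w, hw, hwη⟩ := (h1.and (Ioo_mem_nhdsLT hη0)).exists
    exact eventually_lowerProb_lower hT hwη.1 hwη.2 hη hb hb1 hm hk hw
  have hB := tendsto_log_levelMean hT hη0.le hη.le hb hb1 hm
  have hup : Tendsto (fun n => Real.log (levelMean (T n) η (m n)) / scale n
      - η * x n / scale n * Real.log η) atTop (𝓝 (-(b ^ 3 / 6) * (1 - η + η * Real.log η))) := by
    convert hB.2.sub (hk.mul_const (Real.log η)) using 2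
    ring
  refine tendsto_order.2 ⟨fun l hl => (hlow l hl).mono fun n h => h.2, fun l hl => ?_⟩
  filter_upwards [hlow _ (sub_one_lt _), hup.eventually (gt_mem_nhds hl), hB.1,
    eventually_gt_atTop 0] with n h1 h2 h3 hn
  refine lt_of_le_of_lt ?_ h2
  have hv := scale_pos hn
  have hlog := Real.log_le_log (mul_pos h1.1 (Real.rpow_pos_of_pos hη0 _))
    (lowerProb_mul_rpow_le (T n) hη0 hη.le (m n) (η * x n))
  rw [Real.log_mul h1.1.ne' (Real.rpow_pos_of_pos hη0 _).ne', Real.log_rpow hη0] at hlog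
  rw [div_le_iff₀ hv]
  field_simp
  linarith

end LowerTail

section CompleteGraph

variable {n : ℕ}

/-- The edges of the complete graph on `Fin n`. -/
abbrev KEdge (n : ℕ) : Type := {e : Sym2 (Fin n) // ¬ e.IsDiag}

/-- The edges of the complete graph with both endpoints in `r`. -/
def edgesWithin (r : Finset (Fin n)) : Finset (KEdge n) :=
  Finset.univ.filter fun e => ∀ v ∈ e.1, v ∈ r

/-- The triangles of the complete graph on `Fin n`, as sets of edges. -/
def triangles (n : ℕ) : Finset (Finset (KEdge n)) :=
  (Finset.powersetCard 3 Finset.univ).image edgesWithin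

lemma mem_edgesWithin {r : Finset (Fin n)} {e : KEdge n} :
    e ∈ edgesWithin r ↔ ∀ v ∈ e.1, v ∈ r := by simp [edgesWithin]

lemma KEdge.exists_eq (e : KEdge n) : ∃ a b, ∃ h : a ≠ b, e = ⟨s(a, b), by simpa using h⟩ := by
  obtain ⟨e, he⟩ := e
  induction e using Sym2.ind with
  | _ a b => exact ⟨a, b, by simpa using he, rfl⟩

lemma card_edgesWithin (r : Finset (Fin n)) : (edgesWithin r).card = r.card.choose 2 := by
  rw [← Sym2.card_image_offDiag, ← Finset.card_map (Function.Embedding.subtype _)]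
  congr 1
  ext e
  induction e using Sym2.ind with
  | _ a b =>
    simp only [Finset.mem_map, Finset.mem_image, Finset.mem_offDiag,
      Function.Embedding.subtype_apply,
      mem_edgesWithin, Subtype.exists, Prod.exists, Function.uncurry_apply_pair]
    constructor
    · rintro ⟨e, he, hr, rfl⟩
      exact ⟨a, b, ⟨hr a (by simp), hr b (by simp), by simpa using he⟩, rfl⟩
    · rintro ⟨c, d, ⟨hc, hd, hcd⟩, h⟩
      rw [← h]
      exact ⟨s(c, d), by simpa using hcd, by simp [hc, hd], rfl⟩

lemma edgesWithin_injOn : Set.InjOn edgesWithin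
    (Finset.powersetCard 3 (Finset.univ : Finset (Fin n)) : Set (Finset (Fin n))) := by
  have key : ∀ r r' : Finset (Fin n), r.card = 3 → edgesWithin r = edgesWithin r' → r ⊆ r' := by
    intro r r' hr h v hv
    obtain ⟨u, hu, huv⟩ := Finset.exists_mem_ne (by omega : 1 < r.card) v
    have h1 : (⟨s(v, u), by simpa using huv.symm⟩ : KEdge n) ∈ edgesWithin r :=
      mem_edgesWithin.2 (by simp [hu, hv])
    rw [h, mem_edgesWithin] at h1
    exact h1 v (by simp)
  intro r hr r' hr' h
  simp only [Finset.mem_coe, Finset.mem_powersetCard, Finset.subset_univ, true_and] at hr hr'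
  exact (key r r' hr h).antisymm (key r' r hr' h.symm)

lemma triangles_filter (p : Finset (KEdge n) → Prop) [DecidablePred p] :
    ((triangles n).filter p).card =
      ((Finset.powersetCard 3 Finset.univ).filter fun r : Finset (Fin n) => p (edgesWithin r)).card := by
  rw [triangles, Finset.filter_image, Finset.card_image_of_injOn]
  exact edgesWithin_injOn.mono (Finset.coe_subset.2 (Finset.filter_subset _ _))

lemma isTriangleSystem_triangles (n : ℕ) : IsTriangleSystem (triangles n) n where
  card_elements := by
    have := Sym2.card_subtype_not_diag (α := Fin n)
    rw [Fintype.card_fin] at this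
    convert this
  card_triples := by
    rw [triangles, Finset.card_image_of_injOn edgesWithin_injOn, Finset.card_powersetCard,
      Finset.card_univ, Fintype.card_fin]
  uniform := by
    intro t ht
    obtain ⟨r, hr, rfl⟩ := Finset.mem_image.1 ht
    rw [card_edgesWithin, (Finset.mem_powersetCard.1 hr).2]
    rfl
  linear := by
    intro e f hef
    rw [triangles_filter, Finset.card_le_one]
    have key : ∀ r : Finset (Fin n), r.card = 3 → e ∈ edgesWithin r → f ∈ edgesWithin r →
        e.1.toFinset ∪ f.1.toFinset = r := by
      intro r hr he hf
      refine Finset.eq_of_subset_of_card_le ?_ ?_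
      · intro v hv
        rcases Finset.mem_union.1 hv with h | h
        · exact mem_edgesWithin.1 he v (by simpa using h)
        · exact mem_edgesWithin.1 hf v (by simpa using h)
      · rw [hr]
        have h2 : e.1.toFinset.card = 2 := Sym2.card_toFinset_of_not_isDiag _ e.2
        have h3 : f.1.toFinset.card = 2 := Sym2.card_toFinset_of_not_isDiag _ f.2
        by_contra hlt
        have h4 : e.1.toFinset = e.1.toFinset ∪ f.1.toFinset :=
          Finset.eq_of_subset_of_card_le Finset.subset_union_left (by omega)
        have h5 : f.1.toFinset = e.1.toFinset ∪ f.1.toFinset :=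
          Finset.eq_of_subset_of_card_le Finset.subset_union_right (by omega)
        have h6 := h4.trans h5.symm
        apply hef
        apply Subtype.ext
        refine Sym2.ext fun v => ?_
        rw [← Sym2.mem_toFinset, h6, Sym2.mem_toFinset]
    intro r hr r' hr'
    simp only [Finset.mem_filter, Finset.mem_powersetCard] at hr hr'
    rw [← key r hr.1.2 hr.2.1 hr.2.2, ← key r' hr'.1.2 hr'.2.1 hr'.2.2]
  regular := by
    intro e
    rw [triangles_filter]
    obtain ⟨a, b, hab, rfl⟩ := e.exists_eq
    have h := Finset.card_filter_powersetCard_subset {a, b} (Finset.univ : Finset (Fin n)) 3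
      (Finset.subset_univ _) (by rw [Finset.card_pair hab]; norm_num)
    rw [Finset.card_pair hab, Finset.card_univ, Fintype.card_fin, Nat.choose_one_right] at h
    rw [← h]
    congr 1
    ext r
    simp [mem_edgesWithin, Finset.insert_subset_iff]

/-- Graphs on `Fin n` correspond to sets of edges of the complete graph. -/
def graphEquiv (n : ℕ) : SimpleGraph (Fin n) ≃ Finset (KEdge n) where
  toFun G := Finset.univ.filter fun e => e.1 ∈ G.edgeSet
  invFun U := SimpleGraph.fromEdgeSet {e | ∃ h, (⟨e, h⟩ : KEdge n) ∈ U}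
  left_inv G := by
    ext a b
    simp only [SimpleGraph.fromEdgeSet_adj, Set.mem_ofPred_eq, Finset.mem_filter, Finset.mem_univ,
      true_and, SimpleGraph.mem_edgeSet]
    constructor
    · rintro ⟨⟨_, h⟩, _⟩; exact h
    · intro h; exact ⟨⟨by simpa using h.ne, h⟩, h.ne⟩
  right_inv U := by
    ext e
    obtain ⟨a, b, hab, rfl⟩ := e.exists_eq
    simp [hab]

lemma card_graphEquiv (G : SimpleGraph (Fin n)) : (graphEquiv n G).card = edgeCount G := by
  have h : G.edgeSet = ((graphEquiv n G).map (Function.Embedding.subtype _) : Set (Sym2 (Fin n))) := by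
    ext e
    simpa [graphEquiv] using fun he => G.not_isDiag_of_mem_edgeSet he
  rw [edgeCount, h, Nat.card_coe_set_eq, Set.ncard_coe_finset, Finset.card_map]

lemma containedCount_graphEquiv (G : SimpleGraph (Fin n)) :
    containedCount (triangles n) (graphEquiv n G) = triCount G := by
  rw [containedCount, triangles_filter, triCount, Nat.card_eq_fintype_card, Fintype.card_subtype]
  congr 1
  ext r
  simp only [Finset.mem_filter, Finset.mem_powersetCard, Finset.subset_univ, true_and,
    Finset.mem_univ, SimpleGraph.isNClique_iff, and_comm (a := G.IsClique r)]
  refine and_congr_right fun _ => ?_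
  constructor
  · intro h a ha b hb hab
    have : (⟨s(a, b), by simpa using hab⟩ : KEdge n) ∈ graphEquiv n G :=
      h (mem_edgesWithin.2 (by simpa using ⟨ha, hb⟩))
    simpa [graphEquiv] using this
  · intro h e he
    obtain ⟨a, b, hab, rfl⟩ := e.exists_eq
    simp only [mem_edgesWithin, Sym2.mem_iff, forall_eq_or_imp, forall_eq] at he
    simpa [graphEquiv] using h he.1 he.2 hab

lemma gnmProb_triCount_le (n m : ℕ) (k : ℝ) :
    gnmProb n m {G | (triCount G : ℝ) ≤ k} = lowerProb (triangles n) m k := by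
  rw [gnmProb, lowerProb, (isTriangleSystem_triangles n).card_elements]
  congr 2
  rw [Nat.card_eq_fintype_card, Fintype.card_subtype]
  refine Finset.card_equiv (graphEquiv n) fun G => ?_
  simp [card_graphEquiv, containedCount_graphEquiv, Finset.mem_powersetCard]

lemma gnmExpTri_eq (n m : ℕ) (hm : 3 ≤ m) (hmn : m ≤ n.choose 2) :
    gnmExpTri n m = (n.choose 3 : ℝ) * (m.choose 3 : ℝ) / ((n.choose 2).choose 3 : ℝ) := by
  have hT := isTriangleSystem_triangles n
  have h1 : (∑ G : SimpleGraph (Fin n), if edgeCount G = m then (triCount G : ℝ) else 0) =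
      ∑ U ∈ Finset.powersetCard m (Finset.univ : Finset (KEdge n)),
        (containedCount (triangles n) U : ℝ) := by
    rw [← Finset.sum_filter]
    refine Finset.sum_equiv (graphEquiv n) (fun G => ?_) fun G _ => ?_
    · simp [card_graphEquiv, Finset.mem_powersetCard]
    · rw [containedCount_graphEquiv]
  have h2 : ∑ U ∈ Finset.powersetCard m (Finset.univ : Finset (KEdge n)),
      containedCount (triangles n) U = n.choose 3 * (n.choose 2 - 3).choose (m - 3) := by
    simp_rw [containedCount, Finset.card_filter]
    rw [Finset.sum_comm, ← hT.card_triples, ← smul_eq_mul, ← Finset.sum_const]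
    refine Finset.sum_congr rfl fun t ht => ?_
    have h := Finset.card_filter_powersetCard_subset t _ m (Finset.subset_univ _)
      (by rw [hT.uniform t ht]; exact hm)
    rw [hT.uniform t ht, Finset.card_univ, hT.card_elements, Finset.card_filter] at h
    convert h
  have h3 := Nat.choose_mul (n := n.choose 2) hm
  rw [gnmExpTri, h1]
  have h2' : ∑ U ∈ Finset.powersetCard m (Finset.univ : Finset (KEdge n)),
      (containedCount (triangles n) U : ℝ) = n.choose 3 * (n.choose 2 - 3).choose (m - 3) := by
    exact_mod_cast h2
  have h3' : ((n.choose 2).choose m : ℝ) * m.choose 3 =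
      (n.choose 2).choose 3 * (n.choose 2 - 3).choose (m - 3) := by exact_mod_cast h3
  have h4 : (0 : ℝ) < (n.choose 2).choose m := by exact_mod_cast Nat.choose_pos hmn
  have h5 : (0 : ℝ) < (n.choose 2).choose 3 := by exact_mod_cast Nat.choose_pos (hm.trans hmn)
  rw [h2', div_eq_div_iff h4.ne' h5.ne']
  linear_combination -(n.choose 3 : ℝ) * h3'

end CompleteGraph

section EdgeNumber

open Topology

variable {b : ℝ} {m : ℕ → ℕ}

lemma tendsto_choose_div_pow (k : ℕ) :
    Tendsto (fun n : ℕ => (n.choose k : ℝ) / (n : ℝ) ^ k) atTop (𝓝 (1 / k.factorial)) := by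
  have h := (isEquivalent_choose k).div
    (Asymptotics.IsEquivalent.refl (u := fun n : ℕ => (n : ℝ) ^ k))
  refine h.symm.tendsto_nhds (tendsto_const_nhds.congr' ?_)
  filter_upwards [eventually_gt_atTop 0] with n hn
  have : (n : ℝ) ≠ 0 := by positivity
  simp only [Pi.div_apply]
  field_simp

lemma tendsto_floor_div_scale (hb : 0 ≤ b) :
    Tendsto (fun n => (⌊b * scale n / 2⌋₊ : ℝ) / scale n) atTop (𝓝 (b / 2)) := by
  refine ((tendsto_nat_floor_mul_div_atTop (by positivity : 0 ≤ b / 2)).comp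
    tendsto_scale).congr fun n => ?_
  simp only [Function.comp]
  rw [mul_div_right_comm]

lemma tendsto_div_sq (hm : Tendsto (fun n => (m n : ℝ) / scale n) atTop (𝓝 (b / 2))) :
    Tendsto (fun n => (m n : ℝ) / (n : ℝ) ^ 2) atTop (𝓝 0) := by
  have h := hm.mul (tendsto_div_sqrt_nat 1)
  rw [mul_zero] at h
  refine h.congr fun n => ?_
  rw [div_mul_div_comm, mul_one, scale_eq, mul_assoc, Real.mul_self_sqrt (Nat.cast_nonneg _), sq]

lemma eventually_le_choose_two
    (hm : Tendsto (fun n => (m n : ℝ) / scale n) atTop (𝓝 (b / 2))) :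
    ∀ᶠ n in atTop, m n ≤ n.choose 2 := by
  have h1 := (tendsto_div_sq hm).eventually (gt_mem_nhds (by norm_num : (0 : ℝ) < 1 / 4))
  have h2 := (tendsto_choose_div_pow 2).eventually (lt_mem_nhds
    (by norm_num : (1 : ℝ) / 4 < 1 / Nat.factorial 2))
  filter_upwards [h1, h2, eventually_gt_atTop 0] with n h1 h2 hn
  have h3 := h1.trans h2
  have : (0 : ℝ) < (n : ℝ) ^ 2 := by positivity
  rw [div_lt_div_iff_of_pos_right this] at h3
  exact_mod_cast h3.le

lemma tendsto_gnmExpTri_div_scale (hb : 0 < b)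
    (hm : Tendsto (fun n => (m n : ℝ) / scale n) atTop (𝓝 (b / 2))) :
    Tendsto (fun n => gnmExpTri n (m n) / scale n) atTop (𝓝 (b ^ 3 / 6)) := by
  have hmtop : Tendsto m atTop atTop := by
    have h := tendsto_scale.atTop_mul_pos (by positivity : 0 < b / 2) hm
    rw [← tendsto_natCast_atTop_iff (R := ℝ)]
    refine h.congr' ?_
    filter_upwards [eventually_gt_atTop 0] with n hn
    exact mul_div_cancel₀ _ (scale_pos hn).ne'
  have hNtop : Tendsto (fun n : ℕ => n.choose 2) atTop atTop := by
    refine tendsto_atTop_mono' _ ?_ (tendsto_sub_atTop_nat 1)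
    filter_upwards [eventually_ge_atTop 2] with n hn
    rw [Nat.choose_two_right, Nat.le_div_iff_mul_le two_pos, mul_comm]
    exact Nat.mul_le_mul_right _ hn
  have h3 := tendsto_choose_div_pow 3
  have hlim := ((h3.mul (h3.comp hmtop)).div (h3.comp hNtop) (by positivity)).mul
    ((hm.pow 3).div ((tendsto_choose_div_pow 2).pow 3) (by positivity))
  have hval : 1 / (Nat.factorial 3 : ℝ) * (1 / Nat.factorial 3) / (1 / Nat.factorial 3) *
      ((b / 2) ^ 3 / (1 / Nat.factorial 2) ^ 3) = b ^ 3 / 6 := by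
    norm_num [Nat.factorial]; ring
  rw [hval] at hlim
  refine hlim.congr' ?_
  filter_upwards [eventually_le_choose_two hm, hmtop.eventually_ge_atTop 3,
    eventually_gt_atTop 0] with n h1 h2 hn
  rw [gnmExpTri_eq n (m n) h2 h1]
  have hs := scale_pos hn
  have hs2 : scale n ^ 2 = (n : ℝ) ^ 3 := by
    rw [scale_eq, mul_pow, Real.sq_sqrt (Nat.cast_nonneg _)]; ring
  have hm0 : (0 : ℝ) < m n := by exact_mod_cast (by omega : 0 < m n)
  have hN0 : (0 : ℝ) < n.choose 2 := by exact_mod_cast (by omega : 0 < n.choose 2)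
  have hN3 : (0 : ℝ) < (n.choose 2).choose 3 := by
    exact_mod_cast Nat.choose_pos (h2.trans h1)
  have hn0 : (0 : ℝ) < n := by exact_mod_cast hn
  simp only [Function.comp, Pi.div_apply]
  field_simp
  rw [hs2]
  ring

end EdgeNumber

section Bipartite

open Topology

variable {n : ℕ}

/-- The edges of the complete bipartite graph between `A` and its complement. -/
def cutEdges (A : Finset (Fin n)) : Finset (KEdge n) :=
  Finset.univ.filter fun e => ∃ a ∈ A, ∃ c ∈ Aᶜ, e.1 = s(a, c)

lemma card_cutEdges (A : Finset (Fin n)) : A.card * Aᶜ.card ≤ (cutEdges A).card := by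
  rw [← Finset.card_product, ← Finset.card_map (Function.Embedding.subtype _)]
  refine Finset.card_le_card_of_injOn (fun p => s(p.1, p.2)) ?_ ?_
  · rintro ⟨a, c⟩ hp
    simp only [Finset.coe_product, Set.mem_prod, Finset.mem_coe, Finset.mem_compl] at hp
    have hac : a ≠ c := fun h => hp.2 (h ▸ hp.1)
    simp only [Finset.coe_map, Set.mem_image, Finset.mem_coe]
    exact ⟨⟨s(a, c), by simpa using hac⟩, Finset.mem_filter.2 ⟨Finset.mem_univ _, a, hp.1, c,
      Finset.mem_compl.2 hp.2, rfl⟩, rfl⟩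
  · rintro ⟨a, c⟩ hp ⟨a', c'⟩ hp' h
    simp only [Finset.coe_product, Set.mem_prod, Finset.mem_coe, Finset.mem_compl] at hp hp'
    rcases Sym2.eq_iff.1 h with h | h
    · exact Prod.ext h.1 h.2
    · exact absurd ((show a = c' from h.1) ▸ hp.1) hp'.2

lemma containedCount_cutEdges (A : Finset (Fin n)) :
    containedCount (triangles n) (cutEdges A) = 0 := by
  refine containedCount_eq_zero fun t ht hsub => ?_
  obtain ⟨r, hr, rfl⟩ := Finset.mem_image.1 ht
  have hr3 := (Finset.mem_powersetCard.1 hr).2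
  obtain ⟨x, hx, y, hy, hxy, hA⟩ := Finset.exists_ne_map_eq_of_card_lt_of_maps_to
    (s := r) (t := (Finset.univ : Finset Prop)) (by rw [hr3]; simp) (f := fun v => v ∈ A)
    (fun _ _ => Finset.mem_coe.2 (Finset.mem_univ _))
  have h := hsub (mem_edgesWithin.2 (by simpa using ⟨hx, hy⟩) :
    (⟨s(x, y), by simpa using hxy⟩ : KEdge n) ∈ edgesWithin r)
  obtain ⟨a, ha, c, hc, hac⟩ := (Finset.mem_filter.1 h).2
  rw [Finset.mem_compl] at hc
  simp only [eq_iff_iff] at hA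
  rcases Sym2.eq_iff.1 hac with ⟨rfl, rfl⟩ | ⟨rfl, rfl⟩ <;> tauto

lemma choose_div_le_lowerProb {E : Type*} [Fintype E] (T : Finset (Finset E)) {M : Finset E}
    (hM : containedCount T M = 0) (m : ℕ) {k : ℝ} (hk : 0 ≤ k) :
    (M.card.choose m : ℝ) / (Fintype.card E).choose m ≤ lowerProb T m k := by
  unfold lowerProb
  refine div_le_div_of_nonneg_right ?_ (Nat.cast_nonneg _)
  rw [← Finset.card_powersetCard]
  refine Nat.cast_le.2 (Finset.card_le_card fun U hU => ?_)
  rw [Finset.mem_powersetCard] at hU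
  refine Finset.mem_filter.2 ⟨Finset.mem_powersetCard.2 ⟨Finset.subset_univ _, hU.2⟩, ?_⟩
  have := containedCount_mono_right T hU.1
  rw [hM, Nat.le_zero] at this
  simpa [this] using hk

lemma lowerProb_le_one {E : Type*} [Fintype E] (T : Finset (Finset E)) (m : ℕ) (k : ℝ) :
    lowerProb T m k ≤ 1 := by
  refine div_le_one_of_le₀ (Nat.cast_le.2 ?_) (Nat.cast_nonneg _)
  refine (Finset.card_filter_le _ _).trans ?_
  rw [Finset.card_powersetCard, Finset.card_univ]

lemma sub_div_pow_le_choose_div {M N m : ℕ} (hN : 0 < N) (hm : m ≤ N) :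
    (((M + 1 - m : ℕ) : ℝ) / N) ^ m ≤ (M.choose m : ℝ) / N.choose m := by
  have h1 := Nat.pow_le_choose (α := ℝ) m M
  have h2 := Nat.choose_le_pow_div (α := ℝ) m N
  have hc : (0 : ℝ) < N.choose m := by exact_mod_cast Nat.choose_pos hm
  have hf : (0 : ℝ) < m.factorial := by exact_mod_cast m.factorial_pos
  have hNm : (0 : ℝ) < (N : ℝ) ^ m := by positivity
  rw [div_pow, div_le_div_iff₀ hNm hc]
  rw [div_le_iff₀ hf] at h1
  rw [le_div_iff₀ hf] at h2
  refine le_of_mul_le_mul_right ?_ hf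
  calc _ = ((M + 1 - m : ℕ) : ℝ) ^ m * (N.choose m * m.factorial) := by ring
    _ ≤ (M.choose m * m.factorial) * N ^ m := mul_le_mul h1 h2 (by positivity) (by positivity)
    _ = _ := by ring

lemma eventually_le_log_lowerProb {b : ℝ} {m : ℕ → ℕ}
    (hmle : ∀ n, (m n : ℝ) ≤ b / 2 * scale n)
    (hm : Tendsto (fun n => (m n : ℝ) / scale n) atTop (𝓝 (b / 2))) {k : ℕ → ℝ}
    (hk : ∀ n, 0 ≤ k n) :
    ∀ᶠ n in atTop, -(b / 2 * Real.log 8) ≤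
      Real.log (lowerProb (triangles n) (m n) (k n)) / scale n := by
  have h1 := (tendsto_div_sq hm).eventually (gt_mem_nhds (by norm_num : (0 : ℝ) < 1 / 16))
  filter_upwards [h1, eventually_le_choose_two hm, eventually_ge_atTop 8] with n h1 h2 hn
  have hn0 : 0 < n := by omega
  have hv := scale_pos hn0
  have hnR : (8 : ℝ) ≤ n := by exact_mod_cast hn
  have hN : 0 < n.choose 2 := Nat.choose_pos (by omega)
  have hNle : (n.choose 2 : ℝ) ≤ (n : ℝ) ^ 2 / 2 := by
    simpa using Nat.choose_le_pow_div (α := ℝ) 2 n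
  obtain ⟨A, -, hA⟩ := Finset.exists_subset_card_eq
    (s := (Finset.univ : Finset (Fin n))) (n := n / 2) (by simp; omega)
  have hM := card_cutEdges A
  rw [Finset.card_compl, Fintype.card_fin, hA] at hM
  have hM' : ((n : ℝ) - 1) / 2 * (n / 2) ≤ (cutEdges A).card := by
    have e1 : ((n : ℝ) - 1) / 2 ≤ (n / 2 : ℕ) := by
      have : n ≤ 2 * (n / 2) + 1 := by omega
      have : (n : ℝ) ≤ 2 * (n / 2 : ℕ) + 1 := by exact_mod_cast this
      linarith
    have e2 : (n : ℝ) / 2 ≤ (n - n / 2 : ℕ) := by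
      have : n ≤ 2 * (n - n / 2) := by omega
      have : (n : ℝ) ≤ 2 * (n - n / 2 : ℕ) := by exact_mod_cast this
      linarith
    calc _ ≤ ((n / 2 : ℕ) : ℝ) * (n - n / 2 : ℕ) := mul_le_mul e1 e2 (by positivity) (by positivity)
      _ ≤ _ := by exact_mod_cast hM
  have hratio : (1 : ℝ) / 8 ≤ (((cutEdges A).card + 1 - m n : ℕ) : ℝ) / n.choose 2 := by
    have hsub : ((cutEdges A).card : ℝ) + 1 - m n ≤ (((cutEdges A).card + 1 - m n : ℕ) : ℝ) := by
      have : (cutEdges A).card + 1 ≤ ((cutEdges A).card + 1 - m n) + m n := by omega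
      have : ((cutEdges A).card : ℝ) + 1 ≤ (((cutEdges A).card + 1 - m n : ℕ) : ℝ) + m n := by
        exact_mod_cast this
      linarith
    rw [div_lt_iff₀ (by positivity)] at h1
    rw [le_div_iff₀ (by exact_mod_cast hN)]
    nlinarith
  have hge : (1 / 8 : ℝ) ^ m n ≤ lowerProb (triangles n) (m n) (k n) := by
    refine (pow_le_pow_left₀ (by norm_num) hratio _).trans
      ((sub_div_pow_le_choose_div hN h2).trans ?_)
    rw [← (isTriangleSystem_triangles n).card_elements]
    exact choose_div_le_lowerProb _ (containedCount_cutEdges A) _ (hk n)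
  have hlog := Real.log_le_log (by positivity) hge
  rw [Real.log_pow, one_div, Real.log_inv] at hlog
  rw [le_div_iff₀ hv]
  have h8 : 0 < Real.log 8 := Real.log_pos (by norm_num)
  nlinarith [hmle n]

end Bipartite

lemma one_sub_add_mul_log_pos {η : ℝ} (h0 : 0 ≤ η) (h1 : η < 1) :
    0 < 1 - η + η * Real.log η := by
  rcases h0.eq_or_lt with rfl | h0
  · simp
  · have := Real.log_lt_sub_one_of_pos (inv_pos.2 h0) (by simpa using h1.ne)
    rw [Real.log_inv] at this
    have h2 := mul_lt_mul_of_pos_left this h0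
    rw [mul_sub, mul_inv_cancel₀ h0.ne'] at h2
    linarith

/-- **Corollary (phase transition in the lower-tail problem for `G(n,m)` for every `η`).** -/
theorem phase_transition_gnm (η : ℝ) (hη : η ∈ Set.Ico (0 : ℝ) 1) :
    ∃ bstar : ℝ, 0 < bstar ∧
      ¬ AnalyticAt ℝ (fun b : ℝ =>
        Filter.liminf (fun n : ℕ =>
          Real.log (gnmProb n ⌊b * (n : ℝ) ^ ((3 : ℝ) / 2) / 2⌋₊
            {G | (triCount G : ℝ) ≤ η * gnmExpTri n ⌊b * (n : ℝ) ^ ((3 : ℝ) / 2) / 2⌋₊}) /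
            (n : ℝ) ^ ((3 : ℝ) / 2)) atTop) bstar := by
  by_contra! hcon
  set φ : ℝ → ℝ := fun b : ℝ =>
        Filter.liminf (fun n : ℕ =>
          Real.log (gnmProb n ⌊b * (n : ℝ) ^ ((3 : ℝ) / 2) / 2⌋₊
            {G | (triCount G : ℝ) ≤ η * gnmExpTri n ⌊b * (n : ℝ) ^ ((3 : ℝ) / 2) / 2⌋₊}) /
            (n : ℝ) ^ ((3 : ℝ) / 2)) atTop with hφ
  have hφ' : ∀ b, φ b = Filter.liminf (fun n : ℕ =>
      Real.log (lowerProb (triangles n) ⌊b * scale n / 2⌋₊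
        (η * gnmExpTri n ⌊b * scale n / 2⌋₊)) / scale n) atTop := by
    intro b
    simp only [hφ, gnmProb_triCount_le, scale]
  have hE : ∀ n m, 0 ≤ gnmExpTri n m := fun n m => by
    unfold gnmExpTri
    refine div_nonneg (Finset.sum_nonneg fun G _ => ?_) (Nat.cast_nonneg _)
    split_ifs <;> positivity
  have hsmall : ∀ b ∈ Set.Ioo (0 : ℝ) (1 / 4),
      φ b = -(b ^ 3 / 6) * (1 - η + η * Real.log η) := by
    intro b hb
    rw [hφ']
    have hm := tendsto_floor_div_scale hb.1.le
    exact (tendsto_log_lowerProb isTriangleSystem_triangles hη.1 hη.2 hb.1 hb.2 hm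
      (tendsto_gnmExpTri_div_scale hb.1 hm)).liminf_eq
  have hlarge : ∀ b, 0 < b → -(b / 2 * Real.log 8) ≤ φ b := by
    intro b hb
    rw [hφ']
    refine le_liminf_of_le ?_ (eventually_le_log_lowerProb (fun n => ?_)
      (tendsto_floor_div_scale hb.le) fun n => mul_nonneg hη.1 (hE _ _))
    · refine IsBoundedUnder.isCoboundedUnder_ge (isBoundedUnder_of ⟨0, fun n => ?_⟩)
      exact div_nonpos_of_nonpos_of_nonneg
        (Real.log_nonpos (lowerProb_nonneg _ _ _) (lowerProb_le_one _ _ _)) (scale_nonneg n)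
    · refine (Nat.floor_le (by have := scale_nonneg n; positivity)).trans_eq ?_
      ring
  have heq := AnalyticOnNhd.eqOn_of_preconnected_of_eventuallyEq (𝕜 := ℝ) (f := φ)
    (g := fun b => -(b ^ 3 / 6) * (1 - η + η * Real.log η)) (U := Set.Ioi 0)
    (fun b hb => hcon b hb) (fun b _ => by fun_prop) isPreconnected_Ioi
    (z₀ := 1 / 8) (by norm_num [Set.mem_Ioi])
    (by
      filter_upwards [Ioo_mem_nhds (by norm_num : (0 : ℝ) < 1 / 8)
        (by norm_num : (1 : ℝ) / 8 < 1 / 4)] with b hb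
      exact hsmall b hb)
  set c := 1 - η + η * Real.log η with hc
  have hc0 : 0 < c := one_sub_add_mul_log_pos hη.1 hη.2
  have h8 : 0 < Real.log 8 := Real.log_pos (by norm_num)
  have key : ∀ b : ℝ, 0 < b → b ^ 2 * c ≤ 3 * Real.log 8 := by
    intro b hb
    have h1 := hlarge b hb
    rw [heq hb] at h1
    refine le_of_mul_le_mul_left ?_ hb
    linarith
  have h1 := key (1 + 3 * Real.log 8 / c) (by positivity)
  have h2 : 3 * Real.log 8 = 3 * Real.log 8 / c * c := by field_simp
  have h3 : 0 < 3 * Real.log 8 / c := by positivity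
  nlinarith [mul_pos h3 hc0, mul_pos (mul_pos h3 h3) hc0]
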